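/- arXiv:2103.05734 — 6 statements merged into one kernel-verified Lean document; each statement's English description precedes it below -/
import Mathlib

section
/- Let Φ be a positive trace-preserving linear map from d×d to d'×d' complex matrices, Q a real-linear functional on Hermitian d×d matrices, and Σ(ρ) = S(Φ(ρ)) − S(ρ) + Q(ρ). Let ρ, φ be density matrices with supp ρ ⊆ supp φ. Then supp Φ(ρ) ⊆ supp Φ(φ), and the one-sided directional derivative of Σ at φ toward ρ exists and equals lim_{λ→0⁺} (Σ((1−λ)φ + λρ) − Σ(φ))/λ = Σ(ρ) − Σ(φ) + S(Φ(ρ)‖Φ(φ)) − S(ρ‖φ). -/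
open Matrix
open scoped ComplexOrder

/-- Spectral logarithm of a Hermitian matrix (eigenvalue 0 ↦ 0 via `Real.log 0 = 0`). -/
noncomputable def matLog {d : ℕ} (A : Matrix (Fin d) (Fin d) ℂ) : Matrix (Fin d) (Fin d) ℂ :=
  if hA : A.IsHermitian then
    (hA.eigenvectorUnitary : Matrix (Fin d) (Fin d) ℂ) *
      Matrix.diagonal (fun i => (Real.log (hA.eigenvalues i) : ℂ)) *
      (star (hA.eigenvectorUnitary : Matrix (Fin d) (Fin d) ℂ))
  else 0

/-- Von Neumann entropy `S(ρ) = -tr(ρ log ρ)`. -/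
noncomputable def vN {d : ℕ} (ρ : Matrix (Fin d) (Fin d) ℂ) : ℝ :=
  -(ρ * matLog ρ).trace.re

/-- Quantum relative entropy `S(ρ‖φ) = tr(ρ (log ρ - log φ))`. -/
noncomputable def qRelEnt {d : ℕ} (ρ φ : Matrix (Fin d) (Fin d) ℂ) : ℝ :=
  ((ρ * (matLog ρ - matLog φ)).trace).re

/-- A density matrix: positive semidefinite with unit trace. -/
def IsDensity {d : ℕ} (ρ : Matrix (Fin d) (Fin d) ℂ) : Prop :=
  ρ.PosSemidef ∧ ρ.trace = 1

/-- Support (= range) inclusion of matrices. -/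
def SuppLE {d : ℕ} (ρ φ : Matrix (Fin d) (Fin d) ℂ) : Prop :=
  LinearMap.range ρ.mulVecLin ≤ LinearMap.range φ.mulVecLin

/-- A positive trace-preserving linear map. -/
def IsPTP {d d' : ℕ} (Φ : Matrix (Fin d) (Fin d) ℂ →ₗ[ℂ] Matrix (Fin d') (Fin d') ℂ) : Prop :=
  (∀ X, X.PosSemidef → (Φ X).PosSemidef) ∧ (∀ X, (Φ X).trace = X.trace)

/-- The EP-type function `Σ(ρ) = S(Φ(ρ)) - S(ρ) + Q(ρ)`. -/
noncomputable def EPfun {d d' : ℕ} (Φ : Matrix (Fin d) (Fin d) ℂ →ₗ[ℂ] Matrix (Fin d') (Fin d') ℂ)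
    (Q : Matrix (Fin d) (Fin d) ℂ →ₗ[ℝ] ℝ) (ρ : Matrix (Fin d) (Fin d) ℂ) : ℝ :=
  vN (Φ ρ) - vN ρ + Q ρ

noncomputable def mf {d : ℕ} {A : Matrix (Fin d) (Fin d) ℂ} (hA : A.IsHermitian) (f : ℝ → ℝ) :
    Matrix (Fin d) (Fin d) ℂ :=
  (hA.eigenvectorUnitary : Matrix (Fin d) (Fin d) ℂ) *
      Matrix.diagonal (fun i => (f (hA.eigenvalues i) : ℂ)) *
      (star (hA.eigenvectorUnitary : Matrix (Fin d) (Fin d) ℂ))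

section
variable {d : ℕ} {A B : Matrix (Fin d) (Fin d) ℂ}

lemma mf_congr (hA : A.IsHermitian) {f g : ℝ → ℝ}
    (h : ∀ i, f (hA.eigenvalues i) = g (hA.eigenvalues i)) : mf hA f = mf hA g := by
  simp only [mf, h]

lemma matLog_eq (hA : A.IsHermitian) : matLog A = mf hA Real.log := by
  simp only [matLog, dif_pos hA, mf]

lemma mf_mul (hA : A.IsHermitian) (f g : ℝ → ℝ) :
    mf hA f * mf hA g = mf hA (fun x => f x * g x) := by
  have h : star (hA.eigenvectorUnitary : Matrix (Fin d) (Fin d) ℂ) *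
      (hA.eigenvectorUnitary : Matrix (Fin d) (Fin d) ℂ) = 1 :=
    Unitary.coe_star_mul_self _
  have h2 : Matrix.diagonal (fun i => ((f (hA.eigenvalues i) * g (hA.eigenvalues i) : ℝ) : ℂ)) =
      Matrix.diagonal (fun i => (f (hA.eigenvalues i) : ℂ)) *
      Matrix.diagonal (fun i => (g (hA.eigenvalues i) : ℂ)) := by
    rw [Matrix.diagonal_mul_diagonal]; simp
  simp only [mf]
  rw [h2]
  simp only [Matrix.mul_assoc]
  rw [← Matrix.mul_assoc (star _) _ (_ * _), h, Matrix.one_mul]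

lemma mf_add (hA : A.IsHermitian) (f g : ℝ → ℝ) :
    mf hA f + mf hA g = mf hA (fun x => f x + g x) := by
  have h2 : Matrix.diagonal (fun i => ((f (hA.eigenvalues i) + g (hA.eigenvalues i) : ℝ) : ℂ)) =
      Matrix.diagonal (fun i => (f (hA.eigenvalues i) : ℂ)) +
      Matrix.diagonal (fun i => (g (hA.eigenvalues i) : ℂ)) := by
    rw [Matrix.diagonal_add]; simp
  simp only [mf]
  rw [h2, Matrix.mul_add, Matrix.add_mul]

lemma mf_one (hA : A.IsHermitian) : mf hA (fun _ => 1) = 1 := by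
  have : star (hA.eigenvectorUnitary : Matrix (Fin d) (Fin d) ℂ) = ((star hA.eigenvectorUnitary : _) : Matrix (Fin d) (Fin d) ℂ) := rfl
  simp [mf]

lemma mf_zero (hA : A.IsHermitian) : mf hA (fun _ => 0) = 0 := by
  simp [mf]

lemma mf_id (hA : A.IsHermitian) : mf hA (fun x => x) = A := by
  conv_rhs => rw [hA.spectral_theorem]
  simp [mf, Unitary.conjStarAlgAut_apply, Function.comp_def]

lemma mf_herm (hA : A.IsHermitian) (f : ℝ → ℝ) : (mf hA f)ᴴ = mf hA f := by
  simp only [mf, Matrix.star_eq_conjTranspose, Matrix.conjTranspose_mul, Matrix.conjTranspose_conjTranspose,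
    Matrix.diagonal_conjTranspose, Matrix.mul_assoc]
  congr 3
  ext i; simp

lemma mf_psd (hA : A.IsHermitian) (f : ℝ → ℝ) (h : ∀ i, 0 ≤ f (hA.eigenvalues i)) :
    (mf hA f).PosSemidef := by
  simp only [mf, Matrix.star_eq_conjTranspose]
  apply Matrix.PosSemidef.mul_mul_conjTranspose_same
  rw [Matrix.posSemidef_diagonal_iff]
  intro i
  exact_mod_cast h i

noncomputable def wt (hA : A.IsHermitian) (hB : B.IsHermitian) (i j : Fin d) : ℝ :=
  Complex.normSq ((star (hA.eigenvectorUnitary : Matrix (Fin d) (Fin d) ℂ) *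
    (hB.eigenvectorUnitary : Matrix (Fin d) (Fin d) ℂ)) i j)

lemma trace_mf (hA : A.IsHermitian) (hB : B.IsHermitian) (f g : ℝ → ℝ) :
    (mf hA f * mf hB g).trace.re =
      ∑ i, ∑ j, wt hA hB i j * (f (hA.eigenvalues i) * g (hB.eigenvalues j)) := by
  set U := (hA.eigenvectorUnitary : Matrix (Fin d) (Fin d) ℂ) with hU
  set V := (hB.eigenvectorUnitary : Matrix (Fin d) (Fin d) ℂ) with hV
  have h1 : (mf hA f * mf hB g).trace =
      (Matrix.diagonal (fun i => (f (hA.eigenvalues i) : ℂ)) * (star U * V) *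
        (Matrix.diagonal (fun i => (g (hB.eigenvalues i) : ℂ)) * (star U * V)ᴴ)).trace := by
    simp only [mf, ← hU, ← hV, Matrix.conjTranspose_mul, Matrix.star_eq_conjTranspose,
      Matrix.conjTranspose_conjTranspose]
    simp only [Matrix.mul_assoc]
    rw [Matrix.trace_mul_comm]
    simp only [Matrix.mul_assoc]
  rw [h1, Matrix.trace, Complex.re_sum]
  refine Finset.sum_congr rfl fun i _ => ?_
  rw [Matrix.diag_apply, Matrix.mul_apply, Complex.re_sum]
  refine Finset.sum_congr rfl fun j _ => ?_
  rw [Matrix.diagonal_mul, Matrix.diagonal_mul, Matrix.conjTranspose_apply, wt, ← hU, ← hV]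
  set z := (star U * V) i j
  simp [Complex.normSq_apply]
  ring

lemma mf_cases (hA : A.IsHermitian) : A * mf hA (fun x => x⁻¹) + mf hA (fun x => if x = 0 then 1 else 0) = 1 := by
  rw [← mf_one hA]
  nth_rw 1 [← mf_id hA]
  rw [mf_mul, mf_add]
  apply mf_congr
  intro i
  by_cases h : hA.eigenvalues i = 0 <;> simp [h]

lemma mf_ker (hA : A.IsHermitian) : A * mf hA (fun x => if x = 0 then 1 else 0) = 0 := by
  rw [← mf_zero hA]
  nth_rw 1 [← mf_id hA]
  rw [mf_mul]
  apply mf_congr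
  intro i
  by_cases h : hA.eigenvalues i = 0 <;> simp [h]

lemma mf_comm (hA : A.IsHermitian) (f : ℝ → ℝ) : mf hA f * A = A * mf hA f := by
  have : mf hA f * mf hA (fun x => x) = mf hA (fun x => x) * mf hA f := by
    rw [mf_mul, mf_mul]; simp only [mul_comm]
  rwa [mf_id] at this

/-- Projection identity from support inclusion. -/
lemma supp_factor (hsupp : SuppLE B A) : ∃ X, B = A * X := by
  have : ∀ j, ∃ v, A *ᵥ v = fun i => B i j := by
    intro j
    have h := hsupp (LinearMap.mem_range_self B.mulVecLin (Pi.single j 1))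
    obtain ⟨v, hv⟩ := h
    refine ⟨v, ?_⟩
    have h2 : A *ᵥ v = B *ᵥ (Pi.single j 1) := hv
    rw [h2]; ext i; simp
  choose v hv using this
  refine ⟨Matrix.of fun i j => v j i, ?_⟩
  ext i j
  have := congrFun (hv j) i
  rw [← this]
  simp [Matrix.mul_apply, Matrix.mulVec, dotProduct]

lemma supp_proj (hA : A.IsHermitian) (hsupp : SuppLE B A) :
    A * mf hA (fun x => x⁻¹) * B = B := by
  obtain ⟨X, rfl⟩ := supp_factor hsupp
  have h := mf_cases hA
  have : (A * mf hA (fun x => x⁻¹)) = 1 - mf hA (fun x => if x = 0 then 1 else 0) := by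
    rw [← h]; abel
  rw [this, sub_mul, one_mul, ← Matrix.mul_assoc, mf_comm, mf_ker]; simp

lemma supp_of_ker (hA : A.IsHermitian) (hB : B.IsHermitian)
    (h : ∀ v, A *ᵥ v = 0 → B *ᵥ v = 0) : SuppLE B A := by
  set P := mf hA (fun x => if x = 0 then 1 else 0) with hP
  have h1 : B * P = 0 := by
    ext i j
    have h3 : A *ᵥ (P *ᵥ Pi.single j 1) = 0 := by
      rw [Matrix.mulVec_mulVec, mf_ker, Matrix.zero_mulVec]
    have h4 := congrFun (h _ h3) i
    rw [Matrix.mulVec_mulVec] at h4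
    simpa using h4
  have h2 : P * B = 0 := by
    have := congrArg Matrix.conjTranspose h1
    rwa [Matrix.conjTranspose_mul, mf_herm, hB.eq, Matrix.conjTranspose_zero] at this
  have h3 : B = A * (mf hA (fun x => x⁻¹) * B) := by
    rw [← Matrix.mul_assoc]
    have : (A * mf hA (fun x => x⁻¹)) = 1 - P := by
      rw [← mf_cases hA]; abel
    rw [this, sub_mul, h2]; simp
  rintro _ ⟨v, rfl⟩
  refine ⟨(mf hA (fun x => x⁻¹) * B) *ᵥ v, ?_⟩
  simp only [Matrix.mulVecLin_apply, Matrix.mulVec_mulVec]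
  rw [← h3]

lemma supp_dom (hA : A.PosSemidef) (hB : B.PosSemidef) (hsupp : SuppLE B A) :
    ∃ c : ℝ, ((c : ℂ) • A - B).PosSemidef := by
  set R := mf hA.1 Real.sqrt with hR
  set T := mf hA.1 (fun x => (Real.sqrt x)⁻¹) with hT
  have hRH : Rᴴ = R := mf_herm _ _
  have hTH : Tᴴ = T := mf_herm _ _
  have hRR : R * R = A := by
    conv_rhs => rw [← mf_id hA.1]
    rw [hR, mf_mul]
    apply mf_congr
    intro i
    exact Real.mul_self_sqrt (hA.eigenvalues_nonneg i)
  have hRT : R * T = A * mf hA.1 (fun x => x⁻¹) := by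
    conv_rhs => enter [1]; rw [← mf_id hA.1]
    rw [hR, hT, mf_mul, mf_mul]
    apply mf_congr
    intro i
    have h0 := hA.eigenvalues_nonneg i
    rcases h0.eq_or_lt with h | h
    · simp [← h]
    · rw [mul_inv_cancel₀ h.ne', mul_inv_cancel₀ (Real.sqrt_pos.2 h).ne']
  have hRTB : R * T * B = B := by rw [hRT]; exact supp_proj _ hsupp
  have hBTR : B * (T * R) = B := by
    have := congrArg Matrix.conjTranspose hRTB
    simpa [Matrix.conjTranspose_mul, hRH, hTH, hB.1.eq] using this
  have hM : (T * B * T).PosSemidef := by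
    have := hB.mul_mul_conjTranspose_same T
    rwa [hTH] at this
  refine ⟨∑ i, hM.1.eigenvalues i, ?_⟩
  set c := ∑ i, hM.1.eigenvalues i with hc
  have hN : ((c : ℂ) • (1 : Matrix (Fin d) (Fin d) ℂ) - T * B * T).PosSemidef := by
    have : (c : ℂ) • (1 : Matrix (Fin d) (Fin d) ℂ) - T * B * T = mf hM.1 (fun x => c - x) := by
      rw [sub_eq_iff_eq_add]
      conv_rhs => enter [2]; rw [← mf_id hM.1]
      rw [mf_add]
      simp only [sub_add_cancel]
      simp [mf, ← Matrix.smul_one_eq_diagonal]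
    rw [this]
    apply mf_psd
    intro i
    exact sub_nonneg.2 (Finset.single_le_sum (f := hM.1.eigenvalues) (fun j _ => hM.eigenvalues_nonneg j) (Finset.mem_univ i))
  have := hN.mul_mul_conjTranspose_same R
  rw [hRH, mul_sub, sub_mul] at this
  convert this using 2
  · simp [hRR]
  · calc B = R * T * B := hRTB.symm
      _ = R * T * (B * (T * R)) := by rw [hBTR]
      _ = _ := by simp only [Matrix.mul_assoc]

lemma supp_map {d' : ℕ} (Φ : Matrix (Fin d) (Fin d) ℂ →ₗ[ℂ] Matrix (Fin d') (Fin d') ℂ)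
    (hΦ : IsPTP Φ) (hA : A.PosSemidef) (hB : B.PosSemidef) (hsupp : SuppLE B A) :
    SuppLE (Φ B) (Φ A) := by
  obtain ⟨c, hc⟩ := supp_dom hA hB hsupp
  have h := hΦ.1 _ hc
  rw [map_sub, map_smul] at h
  have hA' := hΦ.1 _ hA
  have hB' := hΦ.1 _ hB
  apply supp_of_ker hA'.1 hB'.1
  intro v hv
  rw [← hB'.dotProduct_mulVec_zero_iff]
  have h1 := h.dotProduct_mulVec_nonneg v
  have h2 := hB'.dotProduct_mulVec_nonneg v
  rw [Matrix.sub_mulVec, Matrix.smul_mulVec, hv] at h1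
  simp at h1
  exact le_antisymm h1 h2

/-- Two-sided bound on the relative entropy. -/
lemma relEnt_bounds (hA : A.PosSemidef) (hB : B.PosSemidef) (hsupp : SuppLE B A) :
    B.trace.re - A.trace.re ≤ qRelEnt B A ∧
    qRelEnt B A ≤ (B * B * mf hA.1 (fun x => x⁻¹)).trace.re - B.trace.re := by
  have hw0 : ∀ i j, 0 ≤ wt hB.1 hA.1 i j := fun i j => Complex.normSq_nonneg _
  -- vanishing weights
  have hz : ∀ i j, hA.1.eigenvalues j = 0 → wt hB.1 hA.1 i j * hB.1.eigenvalues i = 0 := by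
    have h1 : (B * mf hA.1 (fun x => if x = 0 then 1 else 0)).trace.re = 0 := by
      have : mf hA.1 (fun x => if x = 0 then 1 else 0) * B = 0 := by
        obtain ⟨X, rfl⟩ := supp_factor hsupp
        rw [← Matrix.mul_assoc, mf_comm, mf_ker, Matrix.zero_mul]
      rw [Matrix.trace_mul_comm, this]; simp
    nth_rw 1 [← mf_id hB.1] at h1
    rw [trace_mf] at h1
    have hnn : ∀ i j, 0 ≤ wt hB.1 hA.1 i j *
        (hB.1.eigenvalues i * if hA.1.eigenvalues j = 0 then 1 else 0) := by
      intro i j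
      refine mul_nonneg (hw0 i j) (mul_nonneg (hB.eigenvalues_nonneg i) ?_)
      split_ifs <;> norm_num
    rw [Finset.sum_eq_zero_iff_of_nonneg (fun i _ => Finset.sum_nonneg fun j _ => hnn i j)] at h1
    intro i j hj
    have h2 := h1 i (Finset.mem_univ i)
    rw [Finset.sum_eq_zero_iff_of_nonneg (fun j _ => hnn i j)] at h2
    have h3 := h2 j (Finset.mem_univ j)
    simpa [hj] using h3
  have eB : B.trace.re = ∑ i, ∑ j, wt hB.1 hA.1 i j * (hB.1.eigenvalues i * 1) := by
    rw [← trace_mf hB.1 hA.1 (fun x => x) (fun _ => 1), mf_id, mf_one, mul_one]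
  have eA : A.trace.re = ∑ i, ∑ j, wt hB.1 hA.1 i j * (1 * hA.1.eigenvalues j) := by
    rw [← trace_mf hB.1 hA.1 (fun _ => 1) (fun x => x), mf_id, mf_one, one_mul]
  have eS : qRelEnt B A = (∑ i, ∑ j, wt hB.1 hA.1 i j *
      (hB.1.eigenvalues i * Real.log (hB.1.eigenvalues i) * 1)) -
      ∑ i, ∑ j, wt hB.1 hA.1 i j * (hB.1.eigenvalues i * Real.log (hA.1.eigenvalues j)) := by
    rw [← trace_mf hB.1 hA.1 (fun x => x * Real.log x) (fun _ => 1),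
      ← trace_mf hB.1 hA.1 (fun x => x) Real.log, mf_one, mul_one, ← mf_mul hB.1 (fun x => x),
      mf_id, ← matLog_eq, ← matLog_eq, qRelEnt, mul_sub, Matrix.trace_sub, Complex.sub_re]
  have eQ : (B * B * mf hA.1 (fun x => x⁻¹)).trace.re = ∑ i, ∑ j, wt hB.1 hA.1 i j *
      (hB.1.eigenvalues i * hB.1.eigenvalues i * (hA.1.eigenvalues j)⁻¹) := by
    rw [← trace_mf hB.1 hA.1 (fun x => x * x) (fun x => x⁻¹), ← mf_mul hB.1 (fun x => x), mf_id]
  rw [eB, eA, eS, eQ]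
  simp only [← Finset.sum_sub_distrib, ← mul_sub]
  constructor
  · refine Finset.sum_le_sum fun i _ => Finset.sum_le_sum fun j _ => ?_
    have hw := hw0 i j
    have hzz := hz i j
    have hp := hB.eigenvalues_nonneg i
    have hq := hA.eigenvalues_nonneg j
    generalize wt hB.1 hA.1 i j = w at *
    generalize hB.1.eigenvalues i = p at *
    generalize hA.1.eigenvalues j = q at *
    rcases hq.eq_or_lt with h | h
    · subst h
      have := hzz rfl
      simp [mul_comm p, ← mul_assoc]
      rcases mul_eq_zero.1 this with h | h <;> simp [h]
    · apply mul_le_mul_of_nonneg_left _ hw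
      rcases hp.eq_or_lt with h' | h'
      · subst h'; simp; exact h.le
      · have := Real.log_le_sub_one_of_pos (div_pos h h')
        rw [Real.log_div h.ne' h'.ne'] at this
        have h3 := mul_le_mul_of_nonneg_left this hp
        have h4 : p * (q / p - 1) = q - p := by field_simp
        linarith
  · refine Finset.sum_le_sum fun i _ => Finset.sum_le_sum fun j _ => ?_
    have hw := hw0 i j
    have hzz := hz i j
    have hp := hB.eigenvalues_nonneg i
    have hq := hA.eigenvalues_nonneg j
    generalize wt hB.1 hA.1 i j = w at *
    generalize hB.1.eigenvalues i = p at *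
    generalize hA.1.eigenvalues j = q at *
    rcases hq.eq_or_lt with h | h
    · subst h
      rcases mul_eq_zero.1 (hzz rfl) with h | h <;> simp [h]
    · apply mul_le_mul_of_nonneg_left _ hw
      rcases hp.eq_or_lt with h' | h'
      · subst h'; simp
      · have := Real.log_le_sub_one_of_pos (div_pos h' h)
        rw [Real.log_div h'.ne' h.ne'] at this
        have h3 := mul_le_mul_of_nonneg_left this hp
        have h4 : p * (p / q - 1) = p * p * q⁻¹ - p := by field_simp
        linarith

lemma vN_deriv (hA : A.PosSemidef) (hB : B.PosSemidef) (htr : B.trace = A.trace)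
    (hsupp : SuppLE B A) :
    Filter.Tendsto (fun l : ℝ => (vN ((1 - (l : ℂ)) • A + (l : ℂ) • B) - vN A) / l)
      (nhdsWithin 0 (Set.Ioi 0)) (nhds (vN B - vN A + qRelEnt B A)) := by
  set K := mf hA.1 (fun x => x⁻¹) with hK
  set C := ((B - A) * (B - A) * K).trace.re with hC
  have hKA : K * A = A * K := mf_comm _ _
  have hAK : A * K * A = A := by
    apply supp_proj; exact le_refl _
  have hBK : A * K * B = B := supp_proj _ hsupp
  have hquad : ∀ l : ℝ, (((1 - (l : ℂ)) • A + (l : ℂ) • B) * ((1 - (l : ℂ)) • A + (l : ℂ) • B) * K).trace.re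
      = A.trace.re + l ^ 2 * C := by
    intro l
    have e1 : (A * A * K).trace = A.trace := by
      rw [Matrix.mul_assoc, ← hKA, ← Matrix.mul_assoc, hAK]
    have e2 : (A * B * K).trace = A.trace := by
      rw [Matrix.trace_mul_comm, ← Matrix.mul_assoc, hKA, hBK, htr]
    have e3 : (B * A * K).trace = A.trace := by
      rw [Matrix.mul_assoc, Matrix.trace_mul_comm, hBK, htr]
    have hCC : ((B - A) * (B - A) * K).trace = (B * B * K).trace - A.trace := by
      simp only [sub_mul, mul_sub, Matrix.trace_sub, e1, e2, e3]; ring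
    have : (((1 - (l : ℂ)) • A + (l : ℂ) • B) * ((1 - (l : ℂ)) • A + (l : ℂ) • B) * K).trace
        = A.trace + (l : ℂ) ^ 2 * ((B - A) * (B - A) * K).trace := by
      rw [hCC]
      simp only [add_mul, mul_add, Matrix.trace_add, Matrix.smul_mul, Matrix.mul_smul,
        Matrix.trace_smul, e1, e2, e3, smul_eq_mul]
      ring
    rw [this, hC, Complex.add_re, ← Complex.ofReal_pow, Complex.re_ofReal_mul]
  have htrl : ∀ l : ℝ, ((1 - (l : ℂ)) • A + (l : ℂ) • B).trace = A.trace := by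
    intro l
    simp only [Matrix.trace_add, Matrix.trace_smul, htr, smul_eq_mul]; ring
  have hmain : ∀ l : ℝ, 0 < l → l < 1 →
      0 ≤ qRelEnt ((1 - (l : ℂ)) • A + (l : ℂ) • B) A ∧
      qRelEnt ((1 - (l : ℂ)) • A + (l : ℂ) • B) A ≤ l ^ 2 * C := by
    intro l h0 h1
    have hP : ((1 - (l : ℂ)) • A + (l : ℂ) • B).PosSemidef := by
      apply Matrix.PosSemidef.add
      · apply hA.smul
        have : (0 : ℝ) ≤ 1 - l := by linarith
        exact_mod_cast this
      · apply hB.smul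
        exact_mod_cast h0.le
    have hS : SuppLE ((1 - (l : ℂ)) • A + (l : ℂ) • B) A := by
      rintro _ ⟨v, rfl⟩
      simp only [Matrix.mulVecLin_apply, Matrix.add_mulVec, Matrix.smul_mulVec]
      exact Submodule.add_mem _ (Submodule.smul_mem _ _ ⟨v, rfl⟩)
        (Submodule.smul_mem _ _ (hsupp ⟨v, rfl⟩))
    have := relEnt_bounds hA hP hS
    rw [← hK, hquad, htrl] at this
    constructor <;> linarith [this.1, this.2]
  have hid : ∀ l : ℝ, vN ((1 - (l : ℂ)) • A + (l : ℂ) • B) - vN A =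
      l * (vN B - vN A + qRelEnt B A) - qRelEnt ((1 - (l : ℂ)) • A + (l : ℂ) • B) A := by
    intro l
    have h1 : ((1 - (l : ℂ)) • A + (l : ℂ) • B) = ((1 - l : ℝ) : ℂ) • A + (l : ℂ) • B := by simp
    simp only [vN, qRelEnt, mul_sub, Matrix.trace_sub, Complex.sub_re]
    have h2 : ((((1 - (l : ℂ)) • A + (l : ℂ) • B)) * matLog A).trace.re =
        (1 - l) * (A * matLog A).trace.re + l * (B * matLog A).trace.re := by
      rw [h1, add_mul, Matrix.smul_mul, Matrix.smul_mul, Matrix.trace_add, Matrix.trace_smul,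
        Matrix.trace_smul, smul_eq_mul, smul_eq_mul, Complex.add_re, Complex.re_ofReal_mul,
        Complex.re_ofReal_mul]
    rw [h2]
    ring
  have hev : ∀ᶠ l : ℝ in nhdsWithin 0 (Set.Ioi 0), 0 < l ∧ l < 1 :=
    Ioo_mem_nhdsGT one_pos
  have hlin : Filter.Tendsto (fun l : ℝ => (vN B - vN A + qRelEnt B A) - l * C)
      (nhdsWithin 0 (Set.Ioi 0)) (nhds (vN B - vN A + qRelEnt B A)) := by
    have : Filter.Tendsto (fun l : ℝ => (vN B - vN A + qRelEnt B A) - l * C)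
        (nhds 0) (nhds ((vN B - vN A + qRelEnt B A) - 0 * C)) :=
      Continuous.tendsto (by fun_prop) _
    rw [zero_mul, sub_zero] at this
    exact this.mono_left nhdsWithin_le_nhds
  refine tendsto_of_tendsto_of_tendsto_of_le_of_le' hlin tendsto_const_nhds ?_ ?_
  · filter_upwards [hev] with l hl
    rw [hid, le_div_iff₀ hl.1]
    nlinarith [(hmain l hl.1 hl.2).2]
  · filter_upwards [hev] with l hl
    rw [hid, div_le_iff₀ hl.1]
    nlinarith [(hmain l hl.1 hl.2).1]

end

theorem ep_directional_derivative {d d' : ℕ} (hd : 1 ≤ d) (hd' : 1 ≤ d')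
    (Φ : Matrix (Fin d) (Fin d) ℂ →ₗ[ℂ] Matrix (Fin d') (Fin d') ℂ) (hΦ : IsPTP Φ)
    (Q : Matrix (Fin d) (Fin d) ℂ →ₗ[ℝ] ℝ)
    (ρ φ : Matrix (Fin d) (Fin d) ℂ) (hρ : IsDensity ρ) (hφ : IsDensity φ)
    (hsupp : SuppLE ρ φ) :
    SuppLE (Φ ρ) (Φ φ) ∧
    Filter.Tendsto
      (fun l : ℝ => (EPfun Φ Q ((1 - (l : ℂ)) • φ + (l : ℂ) • ρ) - EPfun Φ Q φ) / l)
      (nhdsWithin 0 (Set.Ioi 0))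
      (nhds (EPfun Φ Q ρ - EPfun Φ Q φ + (qRelEnt (Φ ρ) (Φ φ) - qRelEnt ρ φ))) := by
  have hs := supp_map Φ hΦ hφ.1 hρ.1 hsupp
  refine ⟨hs, ?_⟩
  have h1 := vN_deriv hφ.1 hρ.1 (by rw [hρ.2, hφ.2]) hsupp
  have h2 := vN_deriv (hΦ.1 _ hφ.1) (hΦ.1 _ hρ.1) (by rw [hΦ.2, hΦ.2, hρ.2, hφ.2]) hs
  have h3 := (h2.sub h1).add_const (Q ρ - Q φ)
  have e : (vN (Φ ρ) - vN (Φ φ) + qRelEnt (Φ ρ) (Φ φ) - (vN ρ - vN φ + qRelEnt ρ φ)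
      + (Q ρ - Q φ)) = EPfun Φ Q ρ - EPfun Φ Q φ + (qRelEnt (Φ ρ) (Φ φ) - qRelEnt ρ φ) := by
    simp only [EPfun]; ring
  rw [← e]
  refine h3.congr' ?_
  filter_upwards [self_mem_nhdsWithin] with l hl
  have hl0 : (l : ℝ) ≠ 0 := ne_of_gt hl
  have hQ : Q ((1 - (l : ℂ)) • φ + (l : ℂ) • ρ) = (1 - l) * Q φ + l * Q ρ := by
    have : (1 - (l : ℂ)) • φ + (l : ℂ) • ρ = (1 - l) • φ + l • ρ := by
      ext i j; simp
    rw [this, map_add, map_smul, map_smul, smul_eq_mul, smul_eq_mul]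
  simp only [EPfun, map_add, map_smul] at hQ ⊢
  rw [hQ]
  field_simp
  ring
end

section
/- Let Φ be a positive trace-preserving linear map from d×d to d'×d' complex matrices, Q a real-linear functional on Hermitian d×d matrices, and Σ(ρ) = S(Φ(ρ)) − S(ρ) + Q(ρ). Let 𝒮 be a convex set of density matrices, let φ ∈ 𝒮 satisfy Σ(φ) ≤ Σ(ω) for all ω ∈ 𝒮, and let ρ ∈ 𝒮 satisfy supp ρ ⊆ supp φ. If in addition there exists λ < 0 such that (1−λ)φ + λρ ∈ 𝒮, then equality holds: Σ(ρ) − Σ(φ) = S(ρ‖φ) − S(Φ(ρ)‖Φ(φ)). -/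
open Matrix
open scoped ComplexOrder

lemma mc_spec {d : ℕ} (A : Matrix (Fin d) (Fin d) ℂ) (hA : A.PosSemidef) :
    ∃ (U : Matrix (Fin d) (Fin d) ℂ) (a : Fin d → ℝ), Uᴴ * U = 1 ∧ U * Uᴴ = 1 ∧ (∀ i, 0 ≤ a i) ∧
      A = U * diagonal (fun i => (a i : ℂ)) * Uᴴ ∧
      matLog A = U * diagonal (fun i => (Real.log (a i) : ℂ)) * Uᴴ := by
  refine ⟨hA.1.eigenvectorUnitary, hA.1.eigenvalues, ?_, ?_, hA.eigenvalues_nonneg, ?_, ?_⟩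
  · exact Unitary.coe_star_mul_self _
  · exact Unitary.coe_mul_star_self _
  · have h := hA.1.spectral_theorem
    rw [Unitary.conjStarAlgAut_apply] at h
    exact h
  · rw [matLog, dif_pos hA.1]
    rfl

/-- overlaps -/
noncomputable def mcW {d : ℕ} (U V : Matrix (Fin d) (Fin d) ℂ) (i j : Fin d) : ℝ :=
  Complex.normSq ((Uᴴ * V) i j)

lemma mc_trace {d : ℕ} (U V : Matrix (Fin d) (Fin d) ℂ) (a b : Fin d → ℝ) :
    ((U * diagonal (fun i => (a i : ℂ)) * Uᴴ) * (V * diagonal (fun i => (b i : ℂ)) * Vᴴ)).trace.re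
      = ∑ i, ∑ j, mcW U V i j * (a i * b j) := by
  have h1 : ((U * diagonal (fun i => (a i : ℂ)) * Uᴴ) *
      (V * diagonal (fun i => (b i : ℂ)) * Vᴴ)).trace
      = ((diagonal (fun i => (a i : ℂ)) * (Uᴴ * V)) * (diagonal (fun i => (b i : ℂ)) *
        (Uᴴ * V)ᴴ)).trace := by
    rw [conjTranspose_mul, conjTranspose_conjTranspose]
    have : (U * diagonal (fun i => (a i : ℂ)) * Uᴴ) * (V * diagonal (fun i => (b i : ℂ)) * Vᴴ)
      = U * (diagonal (fun i => (a i : ℂ)) * Uᴴ * V * diagonal (fun i => (b i : ℂ)) * Vᴴ) := by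
      simp only [Matrix.mul_assoc]
    rw [this, trace_mul_comm]
    simp only [Matrix.mul_assoc]
  rw [h1, Matrix.trace, Complex.re_sum]
  refine Finset.sum_congr rfl fun i _ => ?_
  rw [diag_apply, Matrix.mul_apply, Complex.re_sum]
  refine Finset.sum_congr rfl fun j _ => ?_
  rw [diagonal_mul, diagonal_mul, conjTranspose_apply, mcW]
  have : (a i : ℂ) * (Uᴴ * V) i j * ((b j : ℂ) * star ((Uᴴ * V) i j))
    = ((a i * b j : ℝ) : ℂ) * ((Uᴴ * V) i j * (starRingEnd ℂ) ((Uᴴ * V) i j)) := by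
    rw [starRingEnd_apply]; push_cast; ring
  rw [this, Complex.mul_conj, ← Complex.ofReal_mul, Complex.ofReal_re]
  ring

lemma mc_klein {d : ℕ} (B : Matrix (Fin d) (Fin d) ℂ) (hB : B.PosSemidef) :
    ∃ Bp : Matrix (Fin d) (Fin d) ℂ, B * Bp = Bp * B ∧ B * (B * Bp) = B ∧
      ∀ A : Matrix (Fin d) (Fin d) ℂ, A.PosSemidef → (∀ v, B *ᵥ v = 0 → A *ᵥ v = 0) →
        A.trace = B.trace →
        0 ≤ qRelEnt A B ∧ qRelEnt A B ≤ (A * A * Bp).trace.re - A.trace.re := by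
  obtain ⟨V, b, hV1, hV2, hb, hBe, hBl⟩ := mc_spec B hB
  have hmul : ∀ (U : Matrix (Fin d) (Fin d) ℂ) (f g : Fin d → ℝ), Uᴴ * U = 1 →
      (U * diagonal (fun i => (f i : ℂ)) * Uᴴ) * (U * diagonal (fun i => (g i : ℂ)) * Uᴴ)
        = U * diagonal (fun i => ((f i * g i : ℝ) : ℂ)) * Uᴴ := by
    intro U f g hU
    have : (U * diagonal (fun i => (f i : ℂ)) * Uᴴ) * (U * diagonal (fun i => (g i : ℂ)) * Uᴴ)
      = U * diagonal (fun i => (f i : ℂ)) * (Uᴴ * U) * diagonal (fun i => (g i : ℂ)) * Uᴴ := by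
      simp only [Matrix.mul_assoc]
    rw [this, hU, Matrix.mul_one, Matrix.mul_assoc U, diagonal_mul_diagonal]
    simp
  refine ⟨V * diagonal (fun i => (((b i)⁻¹ : ℝ) : ℂ)) * Vᴴ, ?_, ?_, ?_⟩
  · rw [hBe, hmul _ _ _ hV1, hmul _ _ _ hV1]
    simp only [mul_comm]
  · rw [hBe, hmul _ _ _ hV1, hmul _ _ _ hV1]
    have : ∀ i, b i * (b i * (b i)⁻¹) = b i := by
      intro i
      by_cases h : b i = 0
      · simp [h]
      · field_simp
    simp only [this]
  · intro A hA hker htr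
    obtain ⟨U, a, hU1, hU2, ha, hAe, hAl⟩ := mc_spec A hA
    have one_eq : ∀ W : Matrix (Fin d) (Fin d) ℂ, W * Wᴴ = 1 →
        W * diagonal (fun _ => ((1 : ℝ) : ℂ)) * Wᴴ = 1 := by
      intro W hW
      simp [hW]
    have tA : A.trace.re = ∑ i, ∑ j, mcW U V i j * (a i * 1) := by
      rw [← mc_trace, one_eq V hV2, Matrix.mul_one, ← hAe]
    have tB : B.trace.re = ∑ i, ∑ j, mcW U V i j * (1 * b j) := by
      have := mc_trace U V (fun _ => 1) b
      rw [one_eq U hU2, Matrix.one_mul, ← hBe] at this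
      exact this
    have tAA : (A * matLog A).trace.re =
        ∑ i, ∑ j, mcW U V i j * (a i * Real.log (a i) * 1) := by
      rw [← mc_trace U V (fun i => a i * Real.log (a i)) (fun _ => 1), one_eq V hV2,
        Matrix.mul_one, ← hmul _ _ _ hU1, ← hAe, ← hAl]
    have tAB : (A * matLog B).trace.re =
        ∑ i, ∑ j, mcW U V i j * (a i * Real.log (b j)) := by
      rw [← mc_trace U V a (fun j => Real.log (b j)), ← hAe, ← hBl]
    have tAAB : (A * A * (V * diagonal (fun i => (((b i)⁻¹ : ℝ) : ℂ)) * Vᴴ)).trace.re =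
        ∑ i, ∑ j, mcW U V i j * (a i * a i * (b j)⁻¹) := by
      rw [← mc_trace U V (fun i => a i * a i) (fun j => (b j)⁻¹), ← hmul _ _ _ hU1, ← hAe]
    have hq : qRelEnt A B = ∑ i, ∑ j, mcW U V i j * (a i * Real.log (a i) * 1)
        - ∑ i, ∑ j, mcW U V i j * (a i * Real.log (b j)) := by
      rw [qRelEnt, Matrix.mul_sub, trace_sub, Complex.sub_re, tAA, tAB]
    have hw : ∀ i j, 0 ≤ mcW U V i j := fun i j => Complex.normSq_nonneg _
    have hz : ∀ i j, b j = 0 → a i = 0 ∨ mcW U V i j = 0 := by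
      intro i j hj
      have h1 : B *ᵥ (fun k => V k j) = 0 := by
        have h2 : B * V = V * diagonal (fun i => (b i : ℂ)) := by
          nth_rewrite 1 [hBe]
          rw [Matrix.mul_assoc, hV1, Matrix.mul_one]
        ext k
        have := congrFun (congrFun h2 k) j
        rw [mul_diagonal, hj] at this
        simpa [Matrix.mul_apply, mulVec, dotProduct] using this
      have h3 := hker _ h1
      have h4 : (Uᴴ * (A * V)) i j = 0 := by
        rw [Matrix.mul_apply]
        refine Finset.sum_eq_zero fun k _ => ?_
        have := congrFun h3 k
        have h5 : (A * V) k j = 0 := by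
          simpa [Matrix.mul_apply, mulVec, dotProduct] using this
        rw [h5, mul_zero]
      have h6 : Uᴴ * (A * V) = diagonal (fun i => (a i : ℂ)) * (Uᴴ * V) := by
        nth_rewrite 1 [hAe]
        have : Uᴴ * (U * diagonal (fun i => (a i : ℂ)) * Uᴴ * V)
          = (Uᴴ * U) * (diagonal (fun i => (a i : ℂ)) * (Uᴴ * V)) := by
          simp only [Matrix.mul_assoc]
        rw [this, hU1, Matrix.one_mul]
      rw [h6, diagonal_mul, mul_eq_zero] at h4
      rcases h4 with h | h
      · left; exact_mod_cast h
      · right; rw [mcW, h, map_zero]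
    constructor
    · have h0 : qRelEnt A B = qRelEnt A B - A.trace.re + B.trace.re := by rw [htr]; ring
      rw [h0, hq, tA, tB, ← Finset.sum_sub_distrib, ← Finset.sum_sub_distrib,
        ← Finset.sum_add_distrib]
      refine Finset.sum_nonneg fun i _ => ?_
      rw [← Finset.sum_sub_distrib, ← Finset.sum_sub_distrib,
        ← Finset.sum_add_distrib]
      refine Finset.sum_nonneg fun j _ => ?_
      have e : mcW U V i j * (a i * Real.log (a i) * 1) - mcW U V i j * (a i * Real.log (b j))
        - mcW U V i j * (a i * 1) + mcW U V i j * (1 * b j)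
        = mcW U V i j * (a i * (Real.log (a i) - Real.log (b j)) - a i + b j) := by ring
      rw [e]
      by_cases hw0 : mcW U V i j = 0
      · rw [hw0, zero_mul]
      refine mul_nonneg (hw i j) ?_
      by_cases ha0 : a i = 0
      · rw [ha0]; simpa using hb j
      have hb0 : b j ≠ 0 := fun h => (hz i j h).elim ha0 hw0
      have hap : 0 < a i := lt_of_le_of_ne (ha i) (Ne.symm ha0)
      have hbp : 0 < b j := lt_of_le_of_ne (hb j) (Ne.symm hb0)
      have := Real.log_le_sub_one_of_pos (div_pos hbp hap)
      rw [Real.log_div hb0 ha0] at this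
      have h2 := mul_le_mul_of_nonneg_left this hap.le
      have h3 : a i * (b j / a i - 1) = b j - a i := by field_simp
      rw [h3] at h2
      linarith
    · rw [hq, tA, tAAB, ← Finset.sum_sub_distrib, ← Finset.sum_sub_distrib]
      refine Finset.sum_le_sum fun i _ => ?_
      rw [← Finset.sum_sub_distrib, ← Finset.sum_sub_distrib]
      refine Finset.sum_le_sum fun j _ => ?_
      rw [← mul_sub, ← mul_sub]
      by_cases hw0 : mcW U V i j = 0
      · rw [hw0, zero_mul, zero_mul]
      refine mul_le_mul_of_nonneg_left ?_ (hw i j)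
      by_cases ha0 : a i = 0
      · rw [ha0]; simp
      have hb0 : b j ≠ 0 := fun h => (hz i j h).elim ha0 hw0
      have hap : 0 < a i := lt_of_le_of_ne (ha i) (Ne.symm ha0)
      have hbp : 0 < b j := lt_of_le_of_ne (hb j) (Ne.symm hb0)
      have := Real.log_le_sub_one_of_pos (div_pos hap hbp)
      rw [Real.log_div ha0 hb0] at this
      have h2 := mul_le_mul_of_nonneg_left this hap.le
      rw [div_eq_mul_inv] at h2
      linarith

lemma mc_taylor {d : ℕ} (B D : Matrix (Fin d) (Fin d) ℂ) (hB : B.PosSemidef) (htr : D.trace = 0)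
    (hker : ∀ v, B *ᵥ v = 0 → D *ᵥ v = 0) :
    ∃ C : ℝ, ∀ t : ℝ, (B + (t : ℂ) • D).PosSemidef →
      |vN (B + (t : ℂ) • D) - vN B + t * (D * matLog B).trace.re| ≤ C * t ^ 2 := by
  obtain ⟨Bp, hcomm, hBB, hK⟩ := mc_klein B hB
  refine ⟨(D * D * Bp).trace.re, fun t ht => ?_⟩
  have hDP : D * (B * Bp) = D := by
    have h0 : B * (1 - B * Bp) = 0 := by rw [Matrix.mul_sub, hBB, Matrix.mul_one, sub_self]
    have h1 : D * (1 - B * Bp) = 0 := by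
      ext i j
      have h2 : B *ᵥ (fun k => (1 - B * Bp) k j) = 0 := by
        ext k
        exact congrFun (congrFun h0 k) j
      exact congrFun (hker _ h2) i
    rw [Matrix.mul_sub, Matrix.mul_one, sub_eq_zero] at h1
    exact h1.symm
  have htA : (B + (t : ℂ) • D).trace = B.trace := by
    rw [trace_add, trace_smul, htr, smul_zero, add_zero]
  obtain ⟨h1, h2⟩ := hK (B + (t : ℂ) • D) ht (by
    intro v hv
    rw [add_mulVec, smul_mulVec, hv, hker v hv, smul_zero, add_zero]) htA
  have e1 : vN (B + (t : ℂ) • D) - vN B + t * (D * matLog B).trace.re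
      = - qRelEnt (B + (t : ℂ) • D) B := by
    rw [vN, vN, qRelEnt, Matrix.mul_sub, trace_sub, Complex.sub_re,
      Matrix.add_mul B _ (matLog B), trace_add, Matrix.smul_mul, trace_smul, smul_eq_mul,
      Complex.add_re, Complex.re_ofReal_mul]
    ring
  have e2 : ((B + (t : ℂ) • D) * (B + (t : ℂ) • D) * Bp).trace
      = B.trace + ((t ^ 2 : ℝ) : ℂ) * (D * D * Bp).trace := by
    have a1 : (B * B * Bp).trace = B.trace := by rw [Matrix.mul_assoc, hBB]
    have a2 : (D * B * Bp).trace = 0 := by rw [Matrix.mul_assoc, hDP, htr]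
    have a3 : (B * D * Bp).trace = 0 := by
      rw [trace_mul_comm, ← Matrix.mul_assoc, ← hcomm, trace_mul_comm, hDP, htr]
    simp only [Matrix.add_mul, Matrix.mul_add, Matrix.smul_mul, Matrix.mul_smul, trace_add,
      trace_smul, smul_eq_mul, a1, a2, a3]
    push_cast
    ring
  rw [htA, e2, Complex.add_re, Complex.re_ofReal_mul] at h2
  rw [e1, abs_neg, abs_of_nonneg h1]
  linarith

lemma mc_lin (M K : ℝ) (h : ∀ s : ℝ, 0 ≤ s → s ≤ 1 → 0 ≤ s * M + K * s ^ 2) : 0 ≤ M := by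
  by_contra hM
  push Not at hM
  have hC : 0 < |K| + 1 + (-M) := by have := abs_nonneg K; linarith
  have := h (-M / (|K| + 1 + (-M))) (by apply div_nonneg <;> linarith)
    (by rw [div_le_one hC]; have := abs_nonneg K; linarith)
  have e : -M / (|K| + 1 + -M) * M + K * (-M / (|K| + 1 + -M)) ^ 2
    = (M / (|K| + 1 + -M)) ^ 2 * (K - (|K| + 1 + -M)) := by
    field_simp
    ring
  rw [e] at this
  have h3 : 0 < (M / (|K| + 1 + -M)) ^ 2 := by
    have : M / (|K| + 1 + -M) ≠ 0 := div_ne_zero hM.ne hC.ne'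
    positivity
  have h4 : K - (|K| + 1 + -M) < 0 := by have := le_abs_self K; linarith
  exact absurd this (not_le.mpr (mul_neg_of_pos_of_neg h3 h4))

lemma mc_ker {d : ℕ} (φ ρ : Matrix (Fin d) (Fin d) ℂ) (hρ : ρ.PosSemidef) (l : ℝ) (hl : l < 0)
    (h : ((1 - (l : ℂ)) • φ + (l : ℂ) • ρ).PosSemidef) (v : Fin d → ℂ) (hv : φ *ᵥ v = 0) :
    (ρ - φ) *ᵥ v = 0 := by
  rw [sub_mulVec, hv, sub_zero]
  have h1 := h.dotProduct_mulVec_nonneg v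
  have h2 := hρ.dotProduct_mulVec_nonneg v
  rw [add_mulVec, smul_mulVec, smul_mulVec, hv, smul_zero, zero_add, dotProduct_smul,
    smul_eq_mul] at h1
  rw [← hρ.dotProduct_mulVec_zero_iff v]
  rw [Complex.le_def] at h1 h2
  rw [Complex.re_ofReal_mul] at h1
  apply Complex.ext
  · have h3 := h1.1
    have h4 := h2.1
    simp only [Complex.zero_re] at h3 h4 ⊢
    nlinarith
  · exact h2.2.symm

theorem mismatch_cost_convex_equality {d d' : ℕ} (hd : 1 ≤ d) (hd' : 1 ≤ d')
    (Φ : Matrix (Fin d) (Fin d) ℂ →ₗ[ℂ] Matrix (Fin d') (Fin d') ℂ) (hΦ : IsPTP Φ)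
    (Q : Matrix (Fin d) (Fin d) ℂ →ₗ[ℝ] ℝ)
    (𝒮 : Set (Matrix (Fin d) (Fin d) ℂ)) (h𝒮conv : Convex ℝ 𝒮)
    (h𝒮dens : ∀ ω ∈ 𝒮, IsDensity ω)
    (φ : Matrix (Fin d) (Fin d) ℂ) (hφ𝒮 : φ ∈ 𝒮)
    (hmin : ∀ ω ∈ 𝒮, EPfun Φ Q φ ≤ EPfun Φ Q ω)
    (ρ : Matrix (Fin d) (Fin d) ℂ) (hρ𝒮 : ρ ∈ 𝒮)
    (hsupp : SuppLE ρ φ)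
    (hneg : ∃ l : ℝ, l < 0 ∧ (1 - (l : ℂ)) • φ + (l : ℂ) • ρ ∈ 𝒮) :
    EPfun Φ Q ρ - EPfun Φ Q φ = qRelEnt ρ φ - qRelEnt (Φ ρ) (Φ φ) := by
  obtain ⟨l, hl, hl𝒮⟩ := hneg
  obtain ⟨hP, hT⟩ := hΦ
  have hφ := h𝒮dens φ hφ𝒮
  have hρ := h𝒮dens ρ hρ𝒮
  have hlp := (h𝒮dens _ hl𝒮).1
  have hΦl := hP _ hlp
  rw [map_add, map_smul, map_smul] at hΦl
  have htr : (ρ - φ).trace = 0 := by rw [trace_sub, hρ.2, hφ.2, sub_self]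
  obtain ⟨C1, hC1⟩ := mc_taylor φ (ρ - φ) hφ.1 htr (mc_ker φ ρ hρ.1 l hl hlp)
  obtain ⟨C2, hC2⟩ := mc_taylor (Φ φ) (Φ ρ - Φ φ) (hP _ hφ.1)
    (by rw [← map_sub, hT, htr]) (mc_ker (Φ φ) (Φ ρ) (hP _ hρ.1) l hl hΦl)
  set L : ℝ := -((Φ ρ - Φ φ) * matLog (Φ φ)).trace.re + ((ρ - φ) * matLog φ).trace.re + Q (ρ - φ)
    with hL
  have key : ∀ t : ℝ, φ + (t : ℂ) • (ρ - φ) ∈ 𝒮 → 0 ≤ t * L + (C1 + C2) * t ^ 2 := by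
    intro t ht
    have h1 := hmin _ ht
    have hp := (h𝒮dens _ ht).1
    have h2 := hC1 t hp
    have hp' := hP _ hp
    have e : Φ (φ + (t : ℂ) • (ρ - φ)) = Φ φ + (t : ℂ) • (Φ ρ - Φ φ) := by
      rw [map_add, map_smul, map_sub]
    rw [e] at hp'
    have h3 := hC2 t hp'
    have hQ : Q (φ + (t : ℂ) • (ρ - φ)) = Q φ + t * Q (ρ - φ) := by
      have : (t : ℂ) • (ρ - φ) = t • (ρ - φ) := by
        ext i j; simp
      rw [this, map_add, map_smul, smul_eq_mul]
    rw [EPfun, EPfun, e, hQ] at h1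
    rw [abs_le] at h2 h3
    rw [hL]
    linarith [h2.1, h2.2, h3.1, h3.2]
  have hL1 : 0 ≤ L := by
    refine mc_lin L (C1 + C2) fun s h0 h1 => key s ?_
    have := h𝒮conv hφ𝒮 hρ𝒮 (sub_nonneg.mpr h1) h0 (by ring)
    convert this using 1
    ext i j
    simp
    ring
  have hL2 : 0 ≤ l * L := by
    refine mc_lin (l * L) ((C1 + C2) * l ^ 2) fun s h0 h1 => ?_
    have := key (s * l) ?_
    · linarith
    have := h𝒮conv hφ𝒮 hl𝒮 (sub_nonneg.mpr h1) h0 (by ring)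
    convert this using 1
    ext i j
    simp
    ring
  have hL0 : L = 0 := by nlinarith
  have f1 : qRelEnt ρ φ = -vN ρ + vN φ - ((ρ - φ) * matLog φ).trace.re := by
    simp only [qRelEnt, vN, Matrix.mul_sub, Matrix.sub_mul, trace_sub, Complex.sub_re]
    ring
  have f2 : qRelEnt (Φ ρ) (Φ φ)
      = -vN (Φ ρ) + vN (Φ φ) - ((Φ ρ - Φ φ) * matLog (Φ φ)).trace.re := by
    simp only [qRelEnt, vN, Matrix.mul_sub, Matrix.sub_mul, trace_sub, Complex.sub_re]
    ring
  have hQ : Q (ρ - φ) = Q ρ - Q φ := map_sub _ _ _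
  rw [f1, f2, EPfun, EPfun]
  rw [hL] at hL0
  linarith
end

section
/- Let Φ be a positive trace-preserving linear map from d×d to d'×d' complex matrices, Q a real-linear functional on Hermitian d×d matrices, and Σ(ρ) = S(Φ(ρ)) − S(ρ) + Q(ρ). Let P be a finite set of pairwise orthogonal projection matrices and D_P the set of density matrices ρ with ρ = Σ_{Π∈P} Π ρ Π. If φ ∈ D_P satisfies Σ(φ) ≤ Σ(ω) for all ω ∈ D_P, then for every ρ ∈ D_P with supp ρ ⊆ supp φ, the mismatch cost equals the contraction of relative entropy: Σ(ρ) − Σ(φ) = S(ρ‖φ) − S(Φ(ρ)‖Φ(φ)). -/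
open Matrix
open scoped ComplexOrder

/-- The set of density matrices that are incoherent relative to the projections in `P`,
i.e. `ρ = ∑_{Π ∈ P} Π ρ Π`. -/
def DP {d : ℕ} (P : Finset (Matrix (Fin d) (Fin d) ℂ)) : Set (Matrix (Fin d) (Fin d) ℂ) :=
  {ρ | IsDensity ρ ∧ ρ = ∑ pr ∈ P, pr * ρ * pr}

/-- `P` is a finite set of pairwise orthogonal (Hermitian, idempotent) projection matrices. -/
def IsOrthProjFamily {d : ℕ} (P : Finset (Matrix (Fin d) (Fin d) ℂ)) : Prop :=
  (∀ pr ∈ P, pr.IsHermitian ∧ pr * pr = pr) ∧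
    (∀ pr ∈ P, ∀ pr' ∈ P, pr ≠ pr' → pr * pr' = 0)

noncomputable def spM {d : ℕ} {A : Matrix (Fin d) (Fin d) ℂ} (hA : A.IsHermitian) (f : Fin d → ℝ) :
    Matrix (Fin d) (Fin d) ℂ :=
  (hA.eigenvectorUnitary : Matrix (Fin d) (Fin d) ℂ) * Matrix.diagonal (fun i => (f i : ℂ)) *
      (star (hA.eigenvectorUnitary : Matrix (Fin d) (Fin d) ℂ))

theorem spM_mul {d : ℕ} {A : Matrix (Fin d) (Fin d) ℂ} (hA : A.IsHermitian) (f g : Fin d → ℝ) :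
    spM hA f * spM hA g = spM hA (fun i => f i * g i) := by
  unfold spM
  have h : (star (hA.eigenvectorUnitary : Matrix (Fin d) (Fin d) ℂ)) *
    (hA.eigenvectorUnitary : Matrix (Fin d) (Fin d) ℂ) = 1 := Unitary.coe_star_mul_self _
  simp only [Matrix.mul_assoc]
  rw [← Matrix.mul_assoc (star _) _ (_ * star _), h, Matrix.one_mul,
    ← Matrix.mul_assoc (diagonal _) (diagonal _), Matrix.diagonal_mul_diagonal]
  simp

theorem spM_one {d : ℕ} {A : Matrix (Fin d) (Fin d) ℂ} (hA : A.IsHermitian) :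
    spM hA (fun _ => 1) = 1 := by
  unfold spM
  simp

theorem spM_eig {d : ℕ} {A : Matrix (Fin d) (Fin d) ℂ} (hA : A.IsHermitian) :
    spM hA hA.eigenvalues = A := by
  conv_rhs => rw [hA.spectral_theorem]
  simp [spM, Unitary.conjStarAlgAut_apply, Function.comp_def]

theorem spM_log {d : ℕ} {A : Matrix (Fin d) (Fin d) ℂ} (hA : A.IsHermitian) :
    spM hA (fun i => Real.log (hA.eigenvalues i)) = matLog A := by
  simp [matLog, spM, hA]

theorem spM_psd {d : ℕ} {A : Matrix (Fin d) (Fin d) ℂ} (hA : A.IsHermitian) (f : Fin d → ℝ)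
    (hf : ∀ i, 0 ≤ f i) : (spM hA f).PosSemidef := by
  unfold spM
  rw [Matrix.star_eq_conjTranspose]
  apply Matrix.PosSemidef.mul_mul_conjTranspose_same
  apply Matrix.PosSemidef.diagonal
  intro i
  simpa using hf i

noncomputable def ovW {d : ℕ} {A B : Matrix (Fin d) (Fin d) ℂ} (hA : A.IsHermitian)
    (hB : B.IsHermitian) (i j : Fin d) : ℝ :=
  Complex.normSq (((star (hA.eigenvectorUnitary : Matrix (Fin d) (Fin d) ℂ)) *
    (hB.eigenvectorUnitary : Matrix (Fin d) (Fin d) ℂ)) i j)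

theorem ovW_nonneg {d : ℕ} {A B : Matrix (Fin d) (Fin d) ℂ} (hA : A.IsHermitian)
    (hB : B.IsHermitian) (i j : Fin d) : 0 ≤ ovW hA hB i j := Complex.normSq_nonneg _

theorem trace_spM_mul {d : ℕ} {A B : Matrix (Fin d) (Fin d) ℂ} (hA : A.IsHermitian)
    (hB : B.IsHermitian) (f g : Fin d → ℝ) :
    (spM hA f * spM hB g).trace.re = ∑ i, ∑ j, f i * g j * ovW hA hB i j := by
  unfold spM ovW
  set U := (hA.eigenvectorUnitary : Matrix (Fin d) (Fin d) ℂ)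
  set V := (hB.eigenvectorUnitary : Matrix (Fin d) (Fin d) ℂ)
  have h1 : (U * diagonal (fun i => (f i : ℂ)) * star U *
      (V * diagonal (fun i => (g i : ℂ)) * star V)).trace =
      ((diagonal (fun i => (f i : ℂ)) * (star U * V)) *
        (diagonal (fun i => (g i : ℂ)) * star (star U * V))).trace := by
    rw [star_mul, star_star]
    simp only [Matrix.mul_assoc]
    rw [Matrix.trace_mul_comm]
    simp only [Matrix.mul_assoc]
  rw [h1]
  generalize star U * V = W
  simp only [Matrix.trace, Matrix.diag_apply]
  simp_rw [Matrix.mul_apply (M := diagonal _ * W), Matrix.diagonal_mul, Complex.re_sum,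
    Matrix.star_apply]
  refine Finset.sum_congr rfl fun i _ => Finset.sum_congr rfl fun j _ => ?_
  have : (f i : ℂ) * W i j * ((g j : ℂ) * star (W i j)) =
      ((f i * g j * Complex.normSq (W i j) : ℝ) : ℂ) := by
    push_cast
    rw [Complex.normSq_eq_conj_mul_self]
    simp only [RCLike.star_def]
    ring
  rw [this, Complex.ofReal_re]

theorem trace_spM {d : ℕ} {A B : Matrix (Fin d) (Fin d) ℂ} (hA : A.IsHermitian)
    (hB : B.IsHermitian) (f : Fin d → ℝ) :
    (spM hA f).trace.re = ∑ i, ∑ j, f i * ovW hA hB i j := by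
  have := trace_spM_mul hA hB f (fun _ => 1)
  rw [spM_one, Matrix.mul_one] at this
  simpa using this

theorem trace_spM' {d : ℕ} {A B : Matrix (Fin d) (Fin d) ℂ} (hA : A.IsHermitian)
    (hB : B.IsHermitian) (g : Fin d → ℝ) :
    (spM hB g).trace.re = ∑ i, ∑ j, g j * ovW hA hB i j := by
  have := trace_spM_mul hA hB (fun _ => 1) g
  rw [spM_one, Matrix.one_mul] at this
  simpa using this

theorem trace_mul_psd {d : ℕ} {A B : Matrix (Fin d) (Fin d) ℂ} (hA : A.PosSemidef)
    (hB : B.PosSemidef) : 0 ≤ (A * B).trace.re := by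
  have := trace_spM_mul hA.1 hB.1 hA.1.eigenvalues hB.1.eigenvalues
  rw [spM_eig, spM_eig] at this
  rw [this]
  refine Finset.sum_nonneg fun i _ => Finset.sum_nonneg fun j _ => ?_
  exact mul_nonneg (mul_nonneg (hA.eigenvalues_nonneg i) (hB.eigenvalues_nonneg j))
    (ovW_nonneg _ _ _ _)

theorem ov_zero {d : ℕ} {A B : Matrix (Fin d) (Fin d) ℂ} (hA : A.PosSemidef)
    (hB : B.PosSemidef) (C : ℝ) (hC : (C • B - A).PosSemidef) (j : Fin d)
    (hj : hB.1.eigenvalues j = 0) (i : Fin d) :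
    hA.1.eigenvalues i * ovW hA.1 hB.1 i j = 0 := by
  set e : Fin d → ℝ := fun k => if k = j then 1 else 0 with he
  have hZ : (spM hB.1 e).PosSemidef := spM_psd _ _ fun k => by
    simp only [he]; split_ifs <;> norm_num
  have h1 := trace_mul_psd hC hZ
  have h2 : B * spM hB.1 e = 0 := by
    nth_rewrite 1 [← spM_eig hB.1]
    rw [spM_mul]
    have : (fun i => hB.1.eigenvalues i * e i) = fun _ => 0 := by
      funext k
      simp only [he]
      split_ifs with h
      · rw [h, hj]; simp
      · simp
    rw [this]
    simp [spM]
  have h3 := trace_spM_mul hA.1 hB.1 hA.1.eigenvalues e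
  rw [spM_eig] at h3
  rw [Matrix.sub_mul, Matrix.smul_mul, h2, smul_zero, zero_sub, Matrix.trace_neg, Complex.neg_re,
    h3] at h1
  simp only [he, mul_ite, mul_one, mul_zero, ite_mul, zero_mul, Finset.sum_ite_eq',
    Finset.mem_univ, if_true] at h1
  have hn : ∀ i ∈ Finset.univ, 0 ≤ hA.1.eigenvalues i * ovW hA.1 hB.1 i j := fun i _ =>
    mul_nonneg (hA.eigenvalues_nonneg i) (ovW_nonneg _ _ _ _)
  have h4 : ∑ i, hA.1.eigenvalues i * ovW hA.1 hB.1 i j = 0 :=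
    le_antisymm (by linarith) (Finset.sum_nonneg hn)
  exact (Finset.sum_eq_zero_iff_of_nonneg hn).1 h4 i (Finset.mem_univ _)

theorem qRelEnt_eq {d : ℕ} {A B : Matrix (Fin d) (Fin d) ℂ} (hA : A.IsHermitian)
    (hB : B.IsHermitian) : qRelEnt A B = ∑ i, ∑ j, hA.eigenvalues i *
      (Real.log (hA.eigenvalues i) - Real.log (hB.eigenvalues j)) * ovW hA hB i j := by
  unfold qRelEnt
  rw [Matrix.mul_sub, Matrix.trace_sub, Complex.sub_re]
  have h1 := trace_spM hA hB (fun i => hA.eigenvalues i * Real.log (hA.eigenvalues i))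
  rw [← spM_mul, spM_eig, spM_log] at h1
  have h2 := trace_spM_mul hA hB hA.eigenvalues (fun i => Real.log (hB.eigenvalues i))
  rw [spM_eig, spM_log] at h2
  rw [h1, h2, ← Finset.sum_sub_distrib]
  refine Finset.sum_congr rfl fun i _ => ?_
  rw [← Finset.sum_sub_distrib]
  refine Finset.sum_congr rfl fun j _ => ?_
  ring

theorem klein_ge {d : ℕ} {A B : Matrix (Fin d) (Fin d) ℂ} (hA : A.PosSemidef)
    (hB : B.PosSemidef) (C : ℝ) (hC : (C • B - A).PosSemidef) :
    A.trace.re - B.trace.re ≤ qRelEnt A B := by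
  rw [qRelEnt_eq hA.1 hB.1]
  have h1 := trace_spM hA.1 hB.1 hA.1.eigenvalues
  have h2 := trace_spM' hA.1 hB.1 hB.1.eigenvalues
  rw [spM_eig] at h1 h2
  rw [h1, h2, ← Finset.sum_sub_distrib]
  refine Finset.sum_le_sum fun i _ => ?_
  rw [← Finset.sum_sub_distrib]
  refine Finset.sum_le_sum fun j _ => ?_
  have hz := fun h => ov_zero hA hB C hC j h i
  have hp := hA.eigenvalues_nonneg i
  have hq := hB.eigenvalues_nonneg j
  have hw := ovW_nonneg hA.1 hB.1 i j
  generalize hA.1.eigenvalues i = p at *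
  generalize hB.1.eigenvalues j = q at *
  generalize ovW hA.1 hB.1 i j = w at *
  rcases hq.eq_or_lt with h | hq
  · have := hz h.symm
    subst h
    rcases mul_eq_zero.1 this with h | h <;> simp [h]
  rcases hp.eq_or_lt with h | hp
  · subst h; simp; positivity
  have := Real.log_le_sub_one_of_pos (div_pos hq hp)
  rw [Real.log_div hq.ne' hp.ne'] at this
  have h3 : p * (Real.log q - Real.log p) ≤ q - p := by
    calc _ ≤ p * (q / p - 1) := by gcongr
      _ = q - p := by field_simp
  nlinarith

theorem klein_le {d : ℕ} {A B : Matrix (Fin d) (Fin d) ℂ} (hA : A.PosSemidef)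
    (hB : B.PosSemidef) (C : ℝ) (hC : (C • B - A).PosSemidef) :
    qRelEnt A B ≤ (A * A * spM hB.1 (fun i => (hB.1.eigenvalues i)⁻¹)).trace.re - A.trace.re := by
  rw [qRelEnt_eq hA.1 hB.1]
  have h1 := trace_spM hA.1 hB.1 hA.1.eigenvalues
  rw [spM_eig] at h1
  have h2 := trace_spM_mul hA.1 hB.1 (fun i => hA.1.eigenvalues i * hA.1.eigenvalues i)
    (fun i => (hB.1.eigenvalues i)⁻¹)
  rw [← spM_mul, spM_eig] at h2
  rw [h1, h2, ← Finset.sum_sub_distrib]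
  refine Finset.sum_le_sum fun i _ => ?_
  rw [← Finset.sum_sub_distrib]
  refine Finset.sum_le_sum fun j _ => ?_
  have hz := fun h => ov_zero hA hB C hC j h i
  have hp := hA.eigenvalues_nonneg i
  have hq := hB.eigenvalues_nonneg j
  have hw := ovW_nonneg hA.1 hB.1 i j
  generalize hA.1.eigenvalues i = p at *
  generalize hB.1.eigenvalues j = q at *
  generalize ovW hA.1 hB.1 i j = w at *
  rcases hq.eq_or_lt with h | hq
  · have := hz h.symm
    subst h
    rcases mul_eq_zero.1 this with h | h <;> simp [h]
  rcases hp.eq_or_lt with h | hp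
  · subst h; simp
  have := Real.log_le_sub_one_of_pos (div_pos hp hq)
  rw [Real.log_div hp.ne' hq.ne'] at this
  have h3 : p * (Real.log p - Real.log q) ≤ p * p * q⁻¹ - p := by
    calc _ ≤ p * (p / q - 1) := by gcongr
      _ = _ := by field_simp
  nlinarith

theorem le_trace_smul {d : ℕ} {A : Matrix (Fin d) (Fin d) ℂ} (hA : A.PosSemidef) :
    ∃ c : ℝ, 0 ≤ c ∧ (c • (1 : Matrix (Fin d) (Fin d) ℂ) - A).PosSemidef := by
  refine ⟨∑ i, hA.1.eigenvalues i, Finset.sum_nonneg fun i _ => hA.eigenvalues_nonneg i, ?_⟩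
  have : (∑ i, hA.1.eigenvalues i) • (1 : Matrix (Fin d) (Fin d) ℂ) - A =
      spM hA.1 (fun k => (∑ i, hA.1.eigenvalues i) - hA.1.eigenvalues k) := by
    generalize (∑ i, hA.1.eigenvalues i) = s
    trans s • spM hA.1 (fun _ => 1) - spM hA.1 hA.1.eigenvalues
    · rw [spM_one, spM_eig]
    unfold spM
    rw [← Matrix.smul_mul, ← Matrix.mul_smul, ← Matrix.sub_mul, ← Matrix.mul_sub]
    congr 2
    ext i j
    by_cases h : i = j
    · subst h; simp
    · simp [h]
  rw [this]
  refine spM_psd _ _ fun k => ?_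
  have := Finset.single_le_sum (f := hA.1.eigenvalues) (fun i _ => hA.eigenvalues_nonneg i)
    (Finset.mem_univ k)
  linarith

theorem supp_bound {d : ℕ} {A B : Matrix (Fin d) (Fin d) ℂ} (hA : A.PosSemidef)
    (hB : B.PosSemidef) (h : SuppLE A B) : ∃ c : ℝ, 0 ≤ c ∧ (c • B - A).PosSemidef := by
  have hX : ∃ X, A = B * X := by
    have : ∀ j, ∃ x, B *ᵥ x = A *ᵥ (Pi.single j 1) := fun j => by
      obtain ⟨x, hx⟩ := h ⟨Pi.single j 1, rfl⟩
      exact ⟨x, by simpa using hx⟩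
    choose x hx using this
    refine ⟨Matrix.of fun i j => x j i, ?_⟩
    ext i j
    have := congrFun (hx j) i
    rw [Matrix.mulVec_single_one] at this
    exact this.symm
  obtain ⟨X, hX⟩ := hX
  set R := spM hB.1 (fun i => Real.sqrt (hB.1.eigenvalues i)) with hR
  set T := spM hB.1 (fun i => (Real.sqrt (hB.1.eigenvalues i))⁻¹) with hT
  have hRp : R.PosSemidef := spM_psd _ _ fun i => Real.sqrt_nonneg _
  have hTp : T.PosSemidef := spM_psd _ _ fun i => inv_nonneg.2 (Real.sqrt_nonneg _)
  have hRR : R * R = B := by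
    conv_rhs => rw [← spM_eig hB.1]
    rw [hR, spM_mul]
    congr 1
    funext i
    exact Real.mul_self_sqrt (hB.eigenvalues_nonneg i)
  have hRTB : R * T * R = R := by
    rw [hR, hT, spM_mul, spM_mul]
    congr 1
    funext i
    exact mul_inv_mul_cancel _
  have hRTA : R * T * A = A := by
    rw [hX, ← hRR, ← Matrix.mul_assoc, ← Matrix.mul_assoc, hRTB]
  have hATR : A * T * R = A := by
    have := congrArg Matrix.conjTranspose hRTA
    simpa [Matrix.conjTranspose_mul, hA.1.eq, hRp.1.eq, hTp.1.eq, Matrix.mul_assoc] using this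
  have hM : (T * A * T).PosSemidef := by
    have := hA.mul_mul_conjTranspose_same T
    rwa [hTp.1.eq] at this
  obtain ⟨c, hc, hcM⟩ := le_trace_smul hM
  refine ⟨c, hc, ?_⟩
  have := hcM.mul_mul_conjTranspose_same R
  rw [hRp.1.eq] at this
  convert this using 1
  rw [Matrix.mul_sub, Matrix.sub_mul, Matrix.mul_smul, Matrix.smul_mul, Matrix.mul_one, hRR]
  congr 1
  calc A = R * T * A * T * R := by rw [hRTA, hATR]
    _ = _ := by simp only [Matrix.mul_assoc]

theorem lin_zero (b c δ : ℝ) (hδ : 0 < δ) (h : ∀ t, |t| ≤ δ → 0 ≤ b * t + c * t ^ 2) : b = 0 := by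
  by_contra hb
  have hc : 0 < |c| + 1 := by positivity
  have hb' : 0 < |b| := abs_pos.2 hb
  set s := min δ (|b| / (2 * (|c| + 1))) with hs
  have hs0 : 0 < s := lt_min hδ (by positivity)
  have hs1 : s ≤ δ := min_le_left _ _
  have hs2 : s * (2 * (|c| + 1)) ≤ |b| := by
    rw [← le_div_iff₀ (by positivity)]; exact min_le_right _ _
  have hcc := le_abs_self c
  rcases lt_or_gt_of_ne hb with h0 | h0
  · have := h s (by rwa [abs_of_pos hs0])
    rw [abs_of_neg h0] at hs2
    have : 0 ≤ s * (b + c * s) := by nlinarith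
    have := nonneg_of_mul_nonneg_right this hs0
    nlinarith
  · have := h (-s) (by rwa [abs_neg, abs_of_pos hs0])
    rw [abs_of_pos h0] at hs2
    have : 0 ≤ s * (-b + c * s) := by nlinarith
    have := nonneg_of_mul_nonneg_right this hs0
    nlinarith

theorem psd_rsmul {d : ℕ} {A : Matrix (Fin d) (Fin d) ℂ} (hA : A.PosSemidef) {c : ℝ} (hc : 0 ≤ c) :
    (c • A).PosSemidef := hA.smul hc

/-- Mismatch cost over `D_P`: if `φ` minimizes the EP-type function `Σ` within `D_P`, then for
every `ρ ∈ D_P` with `supp ρ ⊆ supp φ`,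
`Σ(ρ) − Σ(φ) = S(ρ‖φ) − S(Φ(ρ)‖Φ(φ))`. -/
theorem mismatch_cost_DP_equality {d d' : ℕ} (hd : 1 ≤ d) (hd' : 1 ≤ d')
    (Φ : Matrix (Fin d) (Fin d) ℂ →ₗ[ℂ] Matrix (Fin d') (Fin d') ℂ) (hΦ : IsPTP Φ)
    (Q : Matrix (Fin d) (Fin d) ℂ →ₗ[ℝ] ℝ)
    (P : Finset (Matrix (Fin d) (Fin d) ℂ)) (hP : IsOrthProjFamily P)
    (φ : Matrix (Fin d) (Fin d) ℂ) (hφ : φ ∈ DP P)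
    (hmin : ∀ ω ∈ DP P, EPfun Φ Q φ ≤ EPfun Φ Q ω)
    (ρ : Matrix (Fin d) (Fin d) ℂ) (hρ : ρ ∈ DP P)
    (hsupp : SuppLE ρ φ) :
    EPfun Φ Q ρ - EPfun Φ Q φ = qRelEnt ρ φ - qRelEnt (Φ ρ) (Φ φ) := by
  obtain ⟨⟨hφp, hφt⟩, hφP⟩ := hφ
  obtain ⟨⟨hρp, hρt⟩, hρP⟩ := hρ
  have hΦr : ∀ (c : ℝ) X, Φ (c • X) = c • Φ X := fun c X => by
    rw [← Complex.coe_smul c X, map_smul, Complex.coe_smul]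
  have hΦφ := hΦ.1 φ hφp
  obtain ⟨ℓ, hℓ⟩ : ∃ ℓ : Matrix (Fin d) (Fin d) ℂ →ₗ[ℝ] ℝ, ∀ X, ℓ X =
      (X * matLog φ).trace.re - (Φ X * matLog (Φ φ)).trace.re + Q X :=
    ⟨{ toFun := fun X => (X * matLog φ).trace.re - (Φ X * matLog (Φ φ)).trace.re + Q X
       map_add' := fun X Y => by
        simp only [map_add, Matrix.add_mul, Matrix.trace_add, Complex.add_re]; ring
       map_smul' := fun c X => by
        simp only [hΦr, map_smul, Matrix.smul_mul, Matrix.trace_smul, Complex.smul_re,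
          smul_eq_mul, RingHom.id_apply]; ring }, fun X => rfl⟩
  have hEP : ∀ X, EPfun Φ Q X = qRelEnt X φ - qRelEnt (Φ X) (Φ φ) + ℓ X := fun X => by
    rw [hℓ]
    simp only [EPfun, vN, qRelEnt, Matrix.mul_sub, Matrix.trace_sub, Complex.sub_re]
    ring
  have hDφ : qRelEnt φ φ = 0 := by simp [qRelEnt]
  have hDφ' : qRelEnt (Φ φ) (Φ φ) = 0 := by simp [qRelEnt]
  suffices hL : ℓ (ρ - φ) = 0 by
    rw [map_sub] at hL
    rw [hEP, hEP, hDφ, hDφ']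
    linarith
  obtain ⟨C, hC0, hC⟩ := supp_bound hρp hφp hsupp
  set Z := spM hφp.1 (fun i => (hφp.1.eigenvalues i)⁻¹) with hZ
  set b := ((φ * (ρ - φ) + (ρ - φ) * φ) * Z).trace.re with hb
  set c := ((ρ - φ) * (ρ - φ) * Z).trace.re with hc
  have hZ0 : (φ * φ * Z).trace.re = 1 := by
    have : φ * φ * Z = φ := by
      trans spM hφp.1 hφp.1.eigenvalues * spM hφp.1 hφp.1.eigenvalues * Z
      · rw [spM_eig]
      trans spM hφp.1 hφp.1.eigenvalues
      swap
      · rw [spM_eig]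
      rw [hZ, spM_mul, spM_mul]
      congr 1
      funext i
      exact mul_self_mul_inv _
    rw [this, hφt]; simp
  have key : ∀ t : ℝ, |t| ≤ 1 / (C + 1) → 0 ≤ b * t + c * t ^ 2 ∧
      0 ≤ (ℓ (ρ - φ) + b) * t + c * t ^ 2 := by
    intro t ht
    rw [le_div_iff₀ (by positivity)] at ht
    have ht1 : |t| ≤ 1 := by nlinarith [abs_nonneg t]
    have hle := abs_le.1 ht1
    set A := φ + t • (ρ - φ) with hA
    have hAp : A.PosSemidef ∧ ∃ K : ℝ, (K • φ - A).PosSemidef := by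
      rcases le_total 0 t with h | h
      · constructor
        · have : A = (1 - t) • φ + t • ρ := by rw [hA]; module
          rw [this]
          exact (psd_rsmul hφp (by linarith)).add (psd_rsmul hρp h)
        · refine ⟨(1 - t) + t * C, ?_⟩
          have : ((1 - t) + t * C) • φ - A = t • (C • φ - ρ) := by rw [hA]; module
          rw [this]
          exact psd_rsmul hC h
      · rw [abs_of_nonpos h] at ht
        constructor
        · have : A = (1 - t + t * C) • φ + (-t) • (C • φ - ρ) := by rw [hA]; module
          rw [this]
          exact (psd_rsmul hφp (by nlinarith)).add (psd_rsmul hC (by linarith))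
        · refine ⟨1 - t, ?_⟩
          have : (1 - t) • φ - A = (-t) • ρ := by rw [hA]; module
          rw [this]
          exact psd_rsmul hρp (by linarith)
    obtain ⟨hAp, K, hK⟩ := hAp
    have hAt : A.trace = 1 := by
      rw [hA, Matrix.trace_add, Matrix.trace_smul, Matrix.trace_sub, hφt, hρt]; simp
    have hADP : A ∈ DP P := by
      refine ⟨⟨hAp, hAt⟩, ?_⟩
      have h1 : ∀ pr : Matrix (Fin d) (Fin d) ℂ, pr * A * pr =
          pr * φ * pr + t • (pr * ρ * pr - pr * φ * pr) := fun pr => by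
        rw [hA]
        simp only [Matrix.mul_add, Matrix.add_mul, Matrix.mul_smul, Matrix.smul_mul,
          Matrix.mul_sub, Matrix.sub_mul]
      simp only [h1]
      rw [Finset.sum_add_distrib, ← Finset.smul_sum, Finset.sum_sub_distrib, ← hφP, ← hρP]
    have hup := klein_le hAp hφp K hK
    have hlo := klein_ge hAp hφp K hK
    have hK' : (K • Φ φ - Φ A).PosSemidef := by
      have := hΦ.1 _ hK
      rwa [map_sub, hΦr] at this
    have hlo' := klein_ge (hΦ.1 _ hAp) hΦφ K hK'
    rw [hΦ.2, hΦ.2] at hlo'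
    rw [hAt, hφt, sub_self] at hlo hlo'
    have hpoly : (A * A * Z).trace.re = 1 + b * t + c * t ^ 2 := by
      have : A * A * Z = φ * φ * Z + t • ((φ * (ρ - φ) + (ρ - φ) * φ) * Z) +
          (t ^ 2) • ((ρ - φ) * (ρ - φ) * Z) := by
        rw [hA]
        generalize ρ - φ = Y
        simp only [Matrix.mul_add, Matrix.add_mul, Matrix.mul_smul, Matrix.smul_mul, smul_add,
          smul_smul]
        module
      rw [this, Matrix.trace_add, Matrix.trace_add, Matrix.trace_smul, Matrix.trace_smul,
        Complex.add_re, Complex.add_re, Complex.smul_re, Complex.smul_re, hZ0, ← hb, ← hc]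
      simp only [smul_eq_mul]
      ring
    rw [← hZ, hpoly, hAt, Complex.one_re] at hup
    have hm := hmin A hADP
    have hℓA : ℓ A = ℓ φ + t * ℓ (ρ - φ) := by rw [hA, map_add, map_smul, smul_eq_mul]
    rw [hEP, hEP, hDφ, hDφ', hℓA] at hm
    constructor
    · linarith
    · linarith
  have hδ : 0 < 1 / (C + 1) := by positivity
  have e1 := lin_zero b c _ hδ fun t ht => (key t ht).1
  have e2 := lin_zero _ c _ hδ fun t ht => (key t ht).2
  linarith
end

section
/- Let Φ be a positive trace-preserving linear map from d×d to d'×d' complex matrices, Q a real-linear functional on Hermitian d×d matrices, and Σ(ρ) = S(Φ(ρ)) − S(ρ) + Q(ρ). Let P be a finite set of pairwise orthogonal projection matrices and D_P the set of density matrices ρ with ρ = Σ_{Π∈P} Π ρ Π. If φ ∈ D_P satisfies Σ(φ) ≤ Σ(ω) for all ω ∈ D_P, then the image of the support of φ and the images of states orthogonal to φ do not overlap under Φ: for every ρ ∈ D_P with tr(ρφ) = 0, one has tr(Φ(ρ)Φ(φ)) = 0. -/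
open Matrix
open scoped ComplexOrder

open Real in
lemma nml_aux1 (a x : ℝ) (ha : 0 < a) (hx : 0 ≤ x) :
    negMulLog x ≤ negMulLog a + (x - a) * (-log a - 1) := by
  rcases hx.eq_or_lt with rfl | hx
  · simp [negMulLog]; nlinarith
  · have h := Real.log_le_sub_one_of_pos (div_pos ha hx)
    rw [Real.log_div ha.ne' hx.ne'] at h
    have h2 : x * (log a - log x) ≤ x * (a / x - 1) := mul_le_mul_of_nonneg_left h hx.le
    have h3 : x * (a / x - 1) = a - x := by field_simp
    simp only [negMulLog]; nlinarith

open Real in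
lemma real_final {n m : ℕ} (a b : Fin n → ℝ) (x y : Fin m → ℝ)
    (ha : ∀ i, 0 ≤ a i) (hb : ∀ i, 0 ≤ b i)
    (hbs : ∑ i, b i = 1) (hys : ∑ i, y i = 1) (hxs : ∑ i, x i = 1)
    (hxy : ∀ i, x i = 0 ∨ y i = 0) (q : ℝ)
    (hmain : ∀ t : ℝ, 0 < t → t < 1 →
      ∑ i, negMulLog (a i) - ∑ i, negMulLog (x i) ≤
      ∑ i, negMulLog ((1 - t) * a i + t * b i) - ∑ i, negMulLog ((1 - t) * x i + t * y i) + t * q) :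
    ∑ i, a i * b i = 0 := by
  by_contra hne
  set c := ∑ i, (if a i = 0 then b i else 0) with hc
  have hc1 : c < 1 := by
    obtain ⟨i, -, hi⟩ := Finset.exists_ne_zero_of_sum_ne_zero hne
    rw [← hbs]
    apply Finset.sum_lt_sum
    · intro j _; split_ifs <;> simp [hb]
    · refine ⟨i, Finset.mem_univ _, ?_⟩
      have h1 : a i ≠ 0 := left_ne_zero_of_mul hi
      have h2 : b i ≠ 0 := right_ne_zero_of_mul hi
      simp only [h1, if_false]
      exact lt_of_le_of_ne (hb i) h2.symm
  set K := ∑ i, (if a i = 0 then negMulLog (b i) else (b i - a i) * (-log (a i) - 1)) with hK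
  have up : ∀ t : ℝ, 0 < t → t < 1 →
      ∑ i, negMulLog ((1 - t) * a i + t * b i) ≤
        ∑ i, negMulLog (a i) + t * K + c * negMulLog t := by
    intro t h0 h1
    rw [hK, hc, Finset.mul_sum, Finset.sum_mul, ← Finset.sum_add_distrib, ← Finset.sum_add_distrib]
    apply Finset.sum_le_sum
    intro i _
    by_cases h : a i = 0
    · simp only [h, if_true, mul_zero, zero_add, negMulLog_mul, negMulLog_zero]
      linarith
    · simp only [h, if_false]
      have := nml_aux1 (a i) ((1 - t) * a i + t * b i) (lt_of_le_of_ne (ha i) (Ne.symm h))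
        (add_nonneg (mul_nonneg (by linarith) (ha i)) (mul_nonneg h0.le (hb i)))
      nlinarith
  have lo : ∀ t : ℝ, 0 < t → t < 1 →
      (1 - t) * ∑ i, negMulLog (x i) + t * ∑ i, negMulLog (y i) + negMulLog t ≤
      ∑ i, negMulLog ((1 - t) * x i + t * y i) := by
    intro t h0 h1
    have e : ∑ i, negMulLog ((1 - t) * x i + t * y i) =
       ∑ i, ((1 - t) * negMulLog (x i) + t * negMulLog (y i)
         + (y i * negMulLog t + x i * negMulLog (1 - t))) := by
      apply Finset.sum_congr rfl
      intro i _
      rcases hxy i with h | h <;> simp [h, negMulLog_mul] <;> ring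
    rw [e, Finset.sum_add_distrib, Finset.sum_add_distrib, Finset.sum_add_distrib,
      ← Finset.mul_sum, ← Finset.mul_sum, ← Finset.sum_mul, ← Finset.sum_mul, hys, hxs]
    have := negMulLog_nonneg (x := 1 - t) (by linarith) (by linarith)
    linarith
  set C := K + ∑ i, negMulLog (x i) - ∑ i, negMulLog (y i) + q with hC
  have key : ∀ t : ℝ, 0 < t → t < 1 → (1 - c) * (- log t) ≤ C := by
    intro t h0 h1
    have h2 := hmain t h0 h1
    have h3 := up t h0 h1
    have h4 := lo t h0 h1
    have : t * ((1 - c) * (- log t)) ≤ t * C := by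
      simp only [hC]
      have : negMulLog t = t * (-log t) := by simp [negMulLog]
      rw [this] at h3 h4
      nlinarith
    exact le_of_mul_le_mul_left this h0
  have hpos : 0 < (|C| + 1) / (1 - c) := div_pos (by positivity) (by linarith)
  have := key (exp (-((|C| + 1) / (1 - c)))) (exp_pos _) (by rw [exp_lt_one_iff]; linarith)
  rw [log_exp, neg_neg, mul_div_cancel₀ _ (by linarith : (1 - c) ≠ 0)] at this
  linarith [le_abs_self C]

lemma unit_row {n : ℕ} (W : Matrix (Fin n) (Fin n) ℂ) (h : W * Wᴴ = 1) (i : Fin n) :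
    ∑ j, Complex.normSq (W i j) = 1 := by
  have := congrFun (congrFun h i) i
  simp only [Matrix.mul_apply, Matrix.conjTranspose_apply, Matrix.one_apply_eq, RCLike.star_def,
    Complex.mul_conj] at this
  exact_mod_cast this

lemma unit_col {n : ℕ} (W : Matrix (Fin n) (Fin n) ℂ) (h : Wᴴ * W = 1) (j : Fin n) :
    ∑ i, Complex.normSq (W i j) = 1 := by
  have := congrFun (congrFun h j) j
  simp only [Matrix.mul_apply, Matrix.conjTranspose_apply, Matrix.one_apply_eq, RCLike.star_def,
    ← Complex.normSq_eq_conj_mul_self] at this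
  exact_mod_cast this

lemma conj_diag {n : ℕ} (W : Matrix (Fin n) (Fin n) ℂ) (a : Fin n → ℝ) (i : Fin n) :
    (W * diagonal (fun i => (a i : ℂ)) * Wᴴ) i i = ((∑ j, Complex.normSq (W i j) * a j : ℝ) : ℂ) := by
  simp only [Matrix.mul_apply (M := W * _), Matrix.mul_diagonal, Matrix.conjTranspose_apply]
  push_cast
  apply Finset.sum_congr rfl
  intro j _
  rw [← Complex.mul_conj, RCLike.star_def]; ring

open Real in
/-- main Schur-type inequality -/
lemma schur {n : ℕ} (W : Matrix (Fin n) (Fin n) ℂ) (h1 : W * Wᴴ = 1) (h2 : Wᴴ * W = 1)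
    (a : Fin n → ℝ) (ha : ∀ i, 0 ≤ a i) :
    ∑ j, negMulLog (a j) ≤
      ∑ i, negMulLog ((W * diagonal (fun i => (a i : ℂ)) * Wᴴ) i i).re := by
  have : ∑ j, negMulLog (a j) = ∑ i, ∑ j, Complex.normSq (W i j) * negMulLog (a j) := by
    rw [Finset.sum_comm]
    simp_rw [← Finset.sum_mul, unit_col W h2, one_mul]
  rw [this]
  apply Finset.sum_le_sum
  intro i _
  rw [conj_diag, Complex.ofReal_re]
  have := concaveOn_negMulLog.le_map_sum (t := Finset.univ) (w := fun j => Complex.normSq (W i j))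
    (p := a) (fun j _ => Complex.normSq_nonneg _) (unit_row W h1 i) (fun j _ => ha j)
  simpa using this

open Real in
lemma vN_eq {n : ℕ} (A : Matrix (Fin n) (Fin n) ℂ) (hA : A.IsHermitian) :
    vN A = ∑ i, negMulLog (hA.eigenvalues i) := by
  have hs := hA.spectral_theorem
  set U : Matrix (Fin n) (Fin n) ℂ := (hA.eigenvectorUnitary : Matrix (Fin n) (Fin n) ℂ) with hU
  have hUU : star U * U = 1 := Unitary.coe_star_mul_self _
  have e : A * matLog A =
      U * (diagonal (fun i => ((hA.eigenvalues i * log (hA.eigenvalues i) : ℝ) : ℂ)) * star U) := by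
    have : A = U * diagonal (fun i => (hA.eigenvalues i : ℂ)) * star U := by
      conv_lhs => rw [hs]
      simp [Unitary.conjStarAlgAut_apply, hU, Function.comp_def]
    unfold matLog
    rw [dif_pos hA, ← hU]
    refine (congrArg (· * (U * diagonal (fun i => (Real.log (hA.eigenvalues i) : ℂ)) * star U)) this).trans ?_
    rw [show ∀ D E : Matrix (Fin n) (Fin n) ℂ, U * D * star U * (U * E * star U) =
      U * (D * (star U * U) * E * star U) by intros; simp only [Matrix.mul_assoc], hUU]
    simp [diagonal_mul_diagonal]
  rw [vN, e, trace_mul_comm, Matrix.mul_assoc, hUU, Matrix.mul_one, trace_diagonal]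
  simp [negMulLog]

lemma spec' {n : ℕ} (A : Matrix (Fin n) (Fin n) ℂ) (hA : A.IsHermitian) :
    A = (hA.eigenvectorUnitary : Matrix (Fin n) (Fin n) ℂ) *
      diagonal (fun i => (hA.eigenvalues i : ℂ)) *
      (hA.eigenvectorUnitary : Matrix (Fin n) (Fin n) ℂ)ᴴ := by
  conv_lhs => rw [hA.spectral_theorem]
  simp [Unitary.conjStarAlgAut_apply, Function.comp_def, star_eq_conjTranspose]

open Real in
lemma vN_le {n : ℕ} (A : Matrix (Fin n) (Fin n) ℂ) (hA : A.PosSemidef)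
    (V : Matrix (Fin n) (Fin n) ℂ) (h1 : V * Vᴴ = 1) (h2 : Vᴴ * V = 1) :
    vN A ≤ ∑ i, negMulLog ((Vᴴ * A * V) i i).re := by
  rw [vN_eq A hA.1]
  have hs := spec' A hA.1
  have hUU : (hA.1.eigenvectorUnitary : Matrix (Fin n) (Fin n) ℂ)ᴴ *
    (hA.1.eigenvectorUnitary : Matrix (Fin n) (Fin n) ℂ) = 1 := Unitary.coe_star_mul_self _
  have hUU' : (hA.1.eigenvectorUnitary : Matrix (Fin n) (Fin n) ℂ) *
    (hA.1.eigenvectorUnitary : Matrix (Fin n) (Fin n) ℂ)ᴴ = 1 := Unitary.coe_mul_star_self _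
  generalize (hA.1.eigenvectorUnitary : Matrix (Fin n) (Fin n) ℂ) = U at *
  have := schur (Vᴴ * U) (by
      rw [conjTranspose_mul, conjTranspose_conjTranspose,
        show Vᴴ * U * (Uᴴ * V) = Vᴴ * (U * Uᴴ) * V by simp only [Matrix.mul_assoc], hUU', 
        Matrix.mul_one, h2]) (by
      rw [conjTranspose_mul, conjTranspose_conjTranspose,
        show Uᴴ * V * (Vᴴ * U) = Uᴴ * (V * Vᴴ) * U by simp only [Matrix.mul_assoc], h1, 
        Matrix.mul_one, hUU]) hA.1.eigenvalues hA.eigenvalues_nonneg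
  refine this.trans (le_of_eq ?_)
  conv_rhs => rw [hs]
  simp only [conjTranspose_mul, conjTranspose_conjTranspose, Matrix.mul_assoc]

open Real in
lemma le_vN {n : ℕ} (A : Matrix (Fin n) (Fin n) ℂ) (hA : A.IsHermitian)
    (V : Matrix (Fin n) (Fin n) ℂ) (h1 : V * Vᴴ = 1) (h2 : Vᴴ * V = 1) (a : Fin n → ℝ)
    (ha : ∀ i, 0 ≤ a i) (hAa : A = V * diagonal (fun i => (a i : ℂ)) * Vᴴ) :
    ∑ i, negMulLog (a i) ≤ vN A := by
  rw [vN_eq A hA]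
  have hs := spec' A hA
  have hUU : (hA.eigenvectorUnitary : Matrix (Fin n) (Fin n) ℂ)ᴴ *
    (hA.eigenvectorUnitary : Matrix (Fin n) (Fin n) ℂ) = 1 := Unitary.coe_star_mul_self _
  have hUU' : (hA.eigenvectorUnitary : Matrix (Fin n) (Fin n) ℂ) *
    (hA.eigenvectorUnitary : Matrix (Fin n) (Fin n) ℂ)ᴴ = 1 := Unitary.coe_mul_star_self _
  generalize (hA.eigenvectorUnitary : Matrix (Fin n) (Fin n) ℂ) = U at *
  have := schur (Uᴴ * V) (by
      rw [conjTranspose_mul, conjTranspose_conjTranspose,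
        show Uᴴ * V * (Vᴴ * U) = Uᴴ * (V * Vᴴ) * U by simp only [Matrix.mul_assoc], h1, 
        Matrix.mul_one, hUU]) (by
      rw [conjTranspose_mul, conjTranspose_conjTranspose,
        show Vᴴ * U * (Uᴴ * V) = Vᴴ * (U * Uᴴ) * V by simp only [Matrix.mul_assoc], hUU', 
        Matrix.mul_one, h2]) a ha
  refine this.trans (le_of_eq ?_)
  have e : Uᴴ * V * diagonal (fun i => (a i : ℂ)) * (Uᴴ * V)ᴴ =
      diagonal (fun i => (hA.eigenvalues i : ℂ)) := by
    have : Uᴴ * V * diagonal (fun i => (a i : ℂ)) * (Uᴴ * V)ᴴ = Uᴴ * A * U := by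
      rw [hAa]; simp only [conjTranspose_mul, conjTranspose_conjTranspose, Matrix.mul_assoc]
    rw [this]
    calc Uᴴ * A * U = Uᴴ * (U * diagonal (fun i => (hA.eigenvalues i : ℂ)) * Uᴴ) * U := by
          rw [← hs]
      _ = (Uᴴ * U) * diagonal (fun i => (hA.eigenvalues i : ℂ)) * (Uᴴ * U) := by
          simp only [Matrix.mul_assoc]
      _ = _ := by rw [hUU]; simp
  rw [e]; simp

open scoped MatrixOrder in
lemma tr_zero_mul {n : ℕ} (A B : Matrix (Fin n) (Fin n) ℂ) (hA : A.PosSemidef) (hB : B.PosSemidef)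
    (h : (A * B).trace = 0) : A * B = 0 := by
  obtain ⟨X, rfl⟩ := CStarAlgebra.nonneg_iff_eq_star_mul_self.mp hA.nonneg
  obtain ⟨Y, rfl⟩ := CStarAlgebra.nonneg_iff_eq_star_mul_self.mp hB.nonneg
  simp only [star_eq_conjTranspose] at *
  have h2 : ((X * Yᴴ)ᴴ * (X * Yᴴ)).trace = 0 := by
    rw [← h, conjTranspose_mul, conjTranspose_conjTranspose, Matrix.mul_assoc, trace_mul_comm]
    simp only [Matrix.mul_assoc]
  rw [Matrix.trace_conjTranspose_mul_self_eq_zero_iff] at h2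
  rw [show Xᴴ * X * (Yᴴ * Y) = Xᴴ * (X * Yᴴ) * Y by simp only [Matrix.mul_assoc], h2]
  simp

lemma diag_nonneg' {n : ℕ} {F : Matrix (Fin n) (Fin n) ℂ} (hF : F.PosSemidef) (j : Fin n) :
    0 ≤ (F j j).re ∧ F j j = ((F j j).re : ℂ) := by
  have h : 0 ≤ F j j := hF.diag_nonneg
  rw [Complex.le_def] at h
  refine ⟨h.1, Complex.ext (by simp) (by simpa using h.2.symm)⟩

lemma col_zero {n : ℕ} (F : Matrix (Fin n) (Fin n) ℂ) (hF : F.PosSemidef) (m : Fin n → ℝ)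
    (h : F * F = F * diagonal (fun i => (m i : ℂ))) (j : Fin n) (hm : m j ≤ 0) (i : Fin n) :
    F i j = 0 := by
  have h1 := congrFun (congrFun h j) j
  rw [Matrix.mul_diagonal, Matrix.mul_apply] at h1
  have h2 : ∀ k, F j k * F k j = (Complex.normSq (F k j) : ℂ) := by
    intro k
    rw [Complex.normSq_eq_conj_mul_self, ← hF.1.apply j k]; rfl
  simp_rw [h2] at h1
  obtain ⟨hd0, hd1⟩ := diag_nonneg' hF j
  rw [hd1] at h1
  have h3 : ∑ k, Complex.normSq (F k j) = (F j j).re * m j := by exact_mod_cast h1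
  have h4 : Complex.normSq (F i j) ≤ 0 :=
    (Finset.single_le_sum (f := fun k => Complex.normSq (F k j))
      (fun k _ => Complex.normSq_nonneg _) (Finset.mem_univ i)).trans
      (h3.le.trans (mul_nonpos_of_nonneg_of_nonpos hd0 hm))
  exact Complex.normSq_eq_zero.mp (le_antisymm h4 (Complex.normSq_nonneg _))

lemma simdiag {n : ℕ} (φ ρ : Matrix (Fin n) (Fin n) ℂ) (hφ : φ.PosSemidef) (hρ : ρ.PosSemidef)
    (h1 : φ * ρ = 0) (h2 : ρ * φ = 0) :
    ∃ (V : Matrix (Fin n) (Fin n) ℂ) (x y : Fin n → ℝ), V * Vᴴ = 1 ∧ Vᴴ * V = 1 ∧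
      (∀ i, 0 ≤ x i) ∧ (∀ i, 0 ≤ y i) ∧ (∀ i, x i = 0 ∨ y i = 0) ∧
      φ = V * diagonal (fun i => (x i : ℂ)) * Vᴴ ∧ ρ = V * diagonal (fun i => (y i : ℂ)) * Vᴴ := by
  have hM : (φ - ρ).IsHermitian := hφ.1.sub hρ.1
  have hs := spec' _ hM
  have hUU : (hM.eigenvectorUnitary : Matrix (Fin n) (Fin n) ℂ)ᴴ *
    (hM.eigenvectorUnitary : Matrix (Fin n) (Fin n) ℂ) = 1 := Unitary.coe_star_mul_self _
  have hUU' : (hM.eigenvectorUnitary : Matrix (Fin n) (Fin n) ℂ) *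
    (hM.eigenvectorUnitary : Matrix (Fin n) (Fin n) ℂ)ᴴ = 1 := Unitary.coe_mul_star_self _
  generalize (hM.eigenvectorUnitary : Matrix (Fin n) (Fin n) ℂ) = V at *
  generalize hM.eigenvalues = m at *
  obtain ⟨F, hF⟩ : ∃ F, F = Vᴴ * φ * V := ⟨_, rfl⟩
  obtain ⟨R, hR⟩ : ∃ R, R = Vᴴ * ρ * V := ⟨_, rfl⟩
  have pF : F.PosSemidef := hF ▸ hφ.conjTranspose_mul_mul_same V
  have pR : R.PosSemidef := hR ▸ hρ.conjTranspose_mul_mul_same V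
  have bF : φ = V * F * Vᴴ := by
    rw [hF, show V * (Vᴴ * φ * V) * Vᴴ = (V * Vᴴ) * φ * (V * Vᴴ) by simp only [Matrix.mul_assoc],
      hUU']; simp
  have bR : ρ = V * R * Vᴴ := by
    rw [hR, show V * (Vᴴ * ρ * V) * Vᴴ = (V * Vᴴ) * ρ * (V * Vᴴ) by simp only [Matrix.mul_assoc],
      hUU']; simp
  have hFR : F * R = 0 := by
    rw [hF, hR, show Vᴴ * φ * V * (Vᴴ * ρ * V) = Vᴴ * φ * (V * Vᴴ) * ρ * V by
      simp only [Matrix.mul_assoc], hUU', Matrix.mul_one, Matrix.mul_assoc Vᴴ, h1]; simp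
  have hRF : R * F = 0 := by
    rw [hF, hR, show Vᴴ * ρ * V * (Vᴴ * φ * V) = Vᴴ * ρ * (V * Vᴴ) * φ * V by
      simp only [Matrix.mul_assoc], hUU', Matrix.mul_one, Matrix.mul_assoc Vᴴ, h2]; simp
  have hD : F - R = diagonal (fun i => (m i : ℂ)) := by
    have : F - R = Vᴴ * (φ - ρ) * V := by rw [hF, hR, Matrix.mul_sub, Matrix.sub_mul]
    rw [this, hs, show ∀ D, Vᴴ * (V * D * Vᴴ) * V = (Vᴴ * V) * D * (Vᴴ * V) by
      intro D; simp only [Matrix.mul_assoc], hUU]; simp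
  have cF := col_zero F pF m (by rw [← hD, Matrix.mul_sub, hFR, sub_zero])
  have cR := col_zero R pR (fun i => - m i) (by
    have : diagonal (fun i => ((- m i : ℝ) : ℂ)) = R - F := by
      rw [← neg_sub F R, hD, diagonal_neg]; congr 1; ext i; simp
    rw [this, Matrix.mul_sub, hRF, sub_zero])
  have hoff : ∀ i j, i ≠ j → F i j = 0 ∧ R i j = 0 := by
    intro i j hij
    have hd := congrFun (congrFun hD i) j
    rw [diagonal_apply_ne _ hij, Matrix.sub_apply, sub_eq_zero] at hd
    rcases le_total (m j) 0 with h | h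
    · have := cF j h i; exact ⟨this, by rw [← hd, this]⟩
    · have := cR j (by simpa using h) i; exact ⟨by rw [hd, this], this⟩
  have dF : F = diagonal (fun i => ((F i i).re : ℂ)) := by
    ext i j
    by_cases hij : i = j
    · subst hij; rw [diagonal_apply_eq]; exact (diag_nonneg' pF i).2
    · rw [diagonal_apply_ne _ hij]; exact (hoff i j hij).1
  have dR : R = diagonal (fun i => ((R i i).re : ℂ)) := by
    ext i j
    by_cases hij : i = j
    · subst hij; rw [diagonal_apply_eq]; exact (diag_nonneg' pR i).2
    · rw [diagonal_apply_ne _ hij]; exact (hoff i j hij).2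
  refine ⟨V, fun i => (F i i).re, fun i => (R i i).re, hUU', hUU, fun i => (diag_nonneg' pF i).1,
    fun i => (diag_nonneg' pR i).1, ?_, by rw [← dF]; exact bF, by rw [← dR]; exact bR⟩
  intro i
  rcases le_total (m i) 0 with h | h
  · left; simp [cF i h i]
  · right; simp [cR i (by simpa using h) i]

lemma trace_conj {n : ℕ} (V D : Matrix (Fin n) (Fin n) ℂ) (h : Vᴴ * V = 1) :
    (V * D * Vᴴ).trace = D.trace := by
  rw [trace_mul_comm, ← Matrix.mul_assoc, h, Matrix.one_mul]

lemma conj_back {n : ℕ} (V D : Matrix (Fin n) (Fin n) ℂ) (h : Vᴴ * V = 1) :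
    Vᴴ * (V * D * Vᴴ) * V = D := by
  rw [show Vᴴ * (V * D * Vᴴ) * V = (Vᴴ * V) * D * (Vᴴ * V) by
      simp only [Matrix.mul_assoc], h]; simp

/-- If `φ` minimizes the EP-type function within `D_P`, then the image under `Φ` of any state in
`D_P` orthogonal to `φ` stays orthogonal to the image of `φ`:
`tr(ρφ) = 0` implies `tr(Φ(ρ)Φ(φ)) = 0`. -/
theorem minimizer_noninteracting_supports {d d' : ℕ} (hd : 1 ≤ d) (hd' : 1 ≤ d')
    (Φ : Matrix (Fin d) (Fin d) ℂ →ₗ[ℂ] Matrix (Fin d') (Fin d') ℂ) (hΦ : IsPTP Φ)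
    (Q : Matrix (Fin d) (Fin d) ℂ →ₗ[ℝ] ℝ)
    (P : Finset (Matrix (Fin d) (Fin d) ℂ)) (hP : IsOrthProjFamily P)
    (φ : Matrix (Fin d) (Fin d) ℂ) (hφ : φ ∈ DP P)
    (hmin : ∀ ω ∈ DP P, EPfun Φ Q φ ≤ EPfun Φ Q ω) :
    ∀ ρ ∈ DP P, (ρ * φ).trace = 0 → ((Φ ρ) * (Φ φ)).trace = 0 := by
  intro ρ hρ htr
  obtain ⟨⟨pφ, tφ⟩, sφ⟩ := hφ
  obtain ⟨⟨pρ, tρ⟩, sρ⟩ := hρ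
  have h2 : ρ * φ = 0 := tr_zero_mul ρ φ pρ pφ htr
  have h1 : φ * ρ = 0 := tr_zero_mul φ ρ pφ pρ (by rw [trace_mul_comm]; exact htr)
  obtain ⟨V, x, y, hV1, hV2, hx, hy, hxy, ex, ey⟩ := simdiag φ ρ pφ pρ h1 h2
  have pA := hΦ.1 φ pφ
  have pB := hΦ.1 ρ pρ
  obtain ⟨A, hA⟩ : ∃ A, A = Φ φ := ⟨_, rfl⟩
  obtain ⟨B, hB⟩ : ∃ B, B = Φ ρ := ⟨_, rfl⟩
  have tB : B.trace = 1 := by rw [hB, hΦ.2, tρ]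
  rw [← hA] at pA
  rw [← hB] at pB
  rw [← hA, ← hB]
  have hs := spec' _ pA.1
  have hvA := vN_eq A pA.1
  have ha := pA.eigenvalues_nonneg
  have hUU : (pA.1.eigenvectorUnitary : Matrix (Fin d') (Fin d') ℂ)ᴴ *
    (pA.1.eigenvectorUnitary : Matrix (Fin d') (Fin d') ℂ) = 1 := Unitary.coe_star_mul_self _
  have hUU' : (pA.1.eigenvectorUnitary : Matrix (Fin d') (Fin d') ℂ) *
    (pA.1.eigenvectorUnitary : Matrix (Fin d') (Fin d') ℂ)ᴴ = 1 := Unitary.coe_mul_star_self _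
  generalize (pA.1.eigenvectorUnitary : Matrix (Fin d') (Fin d') ℂ) = U at *
  generalize pA.1.eigenvalues = a at *
  obtain ⟨G, hG⟩ : ∃ G, G = Uᴴ * B * U := ⟨_, rfl⟩
  have pG : G.PosSemidef := hG ▸ pB.conjTranspose_mul_mul_same U
  have tG : G.trace = 1 := by
    rw [hG, trace_mul_comm, ← Matrix.mul_assoc, hUU', Matrix.one_mul, tB]
  have fin := real_final a (fun i => (G i i).re) x y ha (fun i => (diag_nonneg' pG i).1)
    (by
      have := congrArg Complex.re tG
      simpa [Matrix.trace] using this)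
    (by
      rw [ey, trace_conj _ _ hV2, trace_diagonal] at tρ
      exact_mod_cast tρ)
    (by
      rw [ex, trace_conj _ _ hV2, trace_diagonal] at tφ
      exact_mod_cast tφ) hxy (Q ρ - Q φ) (by
    intro t h0 h1
    obtain ⟨ω, hω⟩ : ∃ ω, ω = ((1 - t : ℝ) : ℂ) • φ + (t : ℂ) • ρ := ⟨_, rfl⟩
    have pω : ω.PosSemidef := by
      rw [hω]
      exact (pφ.smul (by exact_mod_cast (by linarith : (0:ℝ) ≤ 1 - t))).add
        (pρ.smul (by exact_mod_cast h0.le))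
    have hωD : ω ∈ DP P := by
      refine ⟨⟨pω, ?_⟩, ?_⟩
      · rw [hω, trace_add, trace_smul, trace_smul, tφ, tρ]; simp
      · have : ∑ pr ∈ P, pr * ω * pr = ((1 - t : ℝ) : ℂ) • (∑ pr ∈ P, pr * φ * pr) +
            (t : ℂ) • ∑ pr ∈ P, pr * ρ * pr := by
          rw [Finset.smul_sum, Finset.smul_sum, ← Finset.sum_add_distrib]
          refine Finset.sum_congr rfl fun pr _ => ?_
          rw [hω]; simp [Matrix.mul_add, Matrix.add_mul]
        rw [this, ← sφ, ← sρ, hω]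
    have hm := hmin ω hωD
    unfold EPfun at hm
    have q1 : Q ω = (1 - t) * Q φ + t * Q ρ := by
      have : ω = (1 - t : ℝ) • φ + (t : ℝ) • ρ := by
        rw [hω]; ext i j; simp
      rw [this, map_add, map_smul, map_smul, smul_eq_mul, smul_eq_mul]
    have q2 : Φ ω = ((1 - t : ℝ) : ℂ) • A + (t : ℂ) • B := by
      rw [hω, map_add, map_smul, map_smul, hA, hB]
    have l1 := vN_le (Φ ω) (hΦ.1 ω pω) U hUU' hUU
    have l2 := le_vN ω pω.1 V hV1 hV2 (fun i => (1 - t) * x i + t * y i)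
      (fun i => add_nonneg (mul_nonneg (by linarith) (hx i)) (mul_nonneg h0.le (hy i))) (by
        rw [hω, ex, ey]
        rw [show (fun i => (((1 - t) * x i + t * y i : ℝ) : ℂ)) =
          ((1 - t : ℝ) : ℂ) • (fun i => (x i : ℂ)) + (t : ℂ) • (fun i => (y i : ℂ)) by
            ext i; simp]
        rw [show ∀ f g : Fin d → ℂ, diagonal (f + g) = diagonal f + diagonal g from
          fun f g => (diagonal_add f g).symm, diagonal_smul, diagonal_smul]
        simp [Matrix.mul_add, Matrix.add_mul])
    have l3 := vN_le φ pφ V hV1 hV2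
    have e3 : ∀ i, ((Vᴴ * φ * V) i i).re = x i := by
      intro i; rw [ex, conj_back _ _ hV2]; simp
    have e1 : ∀ i, ((Uᴴ * Φ ω * U) i i).re = (1 - t) * a i + t * (G i i).re := by
      intro i
      have : Uᴴ * Φ ω * U = ((1 - t : ℝ) : ℂ) • diagonal (fun i => (a i : ℂ)) + (t : ℂ) • G := by
        rw [← conj_back U (diagonal (fun i => (a i : ℂ))) hUU, ← hs, hG, q2]
        simp [Matrix.mul_add, Matrix.add_mul]
      rw [this]; simp only [Matrix.add_apply, Matrix.smul_apply, diagonal_apply_eq, smul_eq_mul,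
        Complex.add_re, Complex.re_ofReal_mul, Complex.ofReal_re]
    simp only [e1] at l1
    simp only [e3] at l3
    rw [← hA, q1] at hm
    linarith)
  have e : (B * A).trace = (G * diagonal (fun i => (a i : ℂ))).trace := by
    rw [hG, hs, ← Matrix.mul_assoc, trace_mul_comm]
    simp only [Matrix.mul_assoc]
  rw [e, Matrix.trace]
  simp only [diag_apply, Matrix.mul_diagonal]
  have : ∀ i, G i i * (a i : ℂ) = ((a i * (G i i).re : ℝ) : ℂ) := by
    intro i
    rw [(diag_nonneg' pG i).2]; push_cast; simp [mul_comm]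
  simp_rw [this]
  exact_mod_cast fin
end

section
/- Let Φ be a positive trace-preserving linear map from d×d to d'×d' complex matrices, Q a real-linear functional on Hermitian d×d matrices, and Σ(ρ) = S(Φ(ρ)) − S(ρ) + Q(ρ). Let P be a finite set of pairwise orthogonal projection matrices, D_P the set of density matrices ρ with ρ = Σ_{Π∈P} Π ρ Π, and H_P the range of Σ_{Π∈P} Π. If Φ(ω) is positive definite on its output space for every density matrix ω ∈ D_P (more generally, if any two ω, ω' ∈ D_P whose supports jointly span H_P satisfy tr(Φ(ω)Φ(ω')) > 0), then every φ ∈ D_P with Σ(φ) ≤ Σ(ω) for all ω ∈ D_P has maximal support: supp φ = H_P. -/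
open Matrix
open scoped ComplexOrder

noncomputable def cj {d : ℕ} (U : Matrix (Fin d) (Fin d) ℂ) (x : Fin d → ℝ) :
    Matrix (Fin d) (Fin d) ℂ := U * Matrix.diagonal (fun i => (x i : ℂ)) * Uᴴ

lemma cj_mul {d : ℕ} {U : Matrix (Fin d) (Fin d) ℂ} (hU : Uᴴ * U = 1) (x y : Fin d → ℝ) :
    cj U x * cj U y = cj U (fun i => x i * y i) := by
  unfold cj
  have : U * diagonal (fun i => (x i : ℂ)) * Uᴴ * (U * diagonal (fun i => (y i : ℂ)) * Uᴴ)
      = U * (diagonal (fun i => (x i : ℂ)) * (Uᴴ * U) * diagonal (fun i => (y i : ℂ))) * Uᴴ := by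
    simp only [Matrix.mul_assoc]
  rw [this, hU, Matrix.mul_one, Matrix.diagonal_mul_diagonal]
  simp

lemma cj_trace {d : ℕ} {U : Matrix (Fin d) (Fin d) ℂ} (hU : Uᴴ * U = 1) (x : Fin d → ℝ) :
    (cj U x).trace = ((∑ i, x i : ℝ) : ℂ) := by
  unfold cj
  rw [Matrix.trace_mul_comm, ← Matrix.mul_assoc, hU, Matrix.one_mul, Matrix.trace_diagonal]
  push_cast
  rfl

lemma cj_isHermitian {d : ℕ} (U : Matrix (Fin d) (Fin d) ℂ) (x : Fin d → ℝ) :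
    (cj U x).IsHermitian := by
  unfold cj Matrix.IsHermitian
  rw [Matrix.conjTranspose_mul, Matrix.conjTranspose_mul, Matrix.conjTranspose_conjTranspose,
    Matrix.diagonal_conjTranspose, Matrix.mul_assoc]
  congr 3
  ext i
  simp

lemma cj_posSemidef {d : ℕ} (U : Matrix (Fin d) (Fin d) ℂ) (x : Fin d → ℝ) (hx : ∀ i, 0 ≤ x i) :
    (cj U x).PosSemidef := by
  unfold cj
  apply Matrix.PosSemidef.mul_mul_conjTranspose_same
  apply Matrix.PosSemidef.diagonal
  intro i
  simpa using hx i

lemma cj_comb {d : ℕ} (U : Matrix (Fin d) (Fin d) ℂ) (x y : Fin d → ℝ) (s t : ℝ) :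
    s • cj U x + t • cj U y = cj U (fun i => s * x i + t * y i) := by
  unfold cj
  have : Matrix.diagonal (fun i => ((s * x i + t * y i : ℝ) : ℂ)) =
      s • Matrix.diagonal (fun i => (x i : ℂ)) + t • Matrix.diagonal (fun i => (y i : ℂ)) := by
    ext i j
    by_cases h : i = j
    · subst h; simp
    · simp [h]
  rw [this, Matrix.mul_add, Matrix.add_mul]
  simp

lemma cj_range_le {d : ℕ} {U : Matrix (Fin d) (Fin d) ℂ} (hU : Uᴴ * U = 1) (x y : Fin d → ℝ)
    (h : ∀ i, y i = 0 → x i = 0) :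
    LinearMap.range (cj U x).mulVecLin ≤ LinearMap.range (cj U y).mulVecLin := by
  have : cj U x = cj U y * cj U (fun i => x i / y i) := by
    rw [cj_mul hU]
    congr 1
    ext i
    by_cases hy : y i = 0
    · simp [hy, h i hy]
    · field_simp
  rw [this, Matrix.mulVecLin_mul]
  exact LinearMap.range_comp_le_range _ _

lemma cj_eig {d : ℕ} {A : Matrix (Fin d) (Fin d) ℂ} (hA : A.IsHermitian) :
    A = cj hA.eigenvectorUnitary hA.eigenvalues := by
  have := hA.spectral_theorem
  rw [Unitary.conjStarAlgAut_apply] at this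
  exact this

lemma eigU {d : ℕ} {A : Matrix (Fin d) (Fin d) ℂ} (hA : A.IsHermitian) :
    (hA.eigenvectorUnitary : Matrix (Fin d) (Fin d) ℂ)ᴴ * hA.eigenvectorUnitary = 1 := by
  exact Unitary.coe_star_mul_self hA.eigenvectorUnitary

lemma vN_eig {d : ℕ} {A : Matrix (Fin d) (Fin d) ℂ} (hA : A.IsHermitian) :
    vN A = ∑ i, Real.negMulLog (hA.eigenvalues i) := by
  have h1 : matLog A = cj hA.eigenvectorUnitary (fun i => Real.log (hA.eigenvalues i)) := by
    unfold matLog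
    rw [dif_pos hA]
    rfl
  have h2 : A * matLog A = cj hA.eigenvectorUnitary
      (fun i => hA.eigenvalues i * Real.log (hA.eigenvalues i)) := by
    rw [h1]
    conv_lhs => rw [show A * cj hA.eigenvectorUnitary (fun i => Real.log (hA.eigenvalues i)) =
      cj hA.eigenvectorUnitary hA.eigenvalues *
        cj hA.eigenvectorUnitary (fun i => Real.log (hA.eigenvalues i)) by rw [← cj_eig hA]]
    rw [cj_mul (eigU hA)]
  unfold vN
  rw [h2, cj_trace (eigU hA), Complex.ofReal_re, Real.negMulLog_eq_neg]
  simp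

lemma vN_cj {d : ℕ} {U : Matrix (Fin d) (Fin d) ℂ} (hU : Uᴴ * U = 1) (x : Fin d → ℝ) :
    vN (cj U x) = ∑ i, Real.negMulLog (x i) := by
  have hA := cj_isHermitian U x
  rw [vN_eig hA]
  have h1 := hA.roots_charpoly_eq_eigenvalues
  have h2 : (cj U x).charpoly = ∏ i, (Polynomial.X - Polynomial.C (x i : ℂ)) := by
    unfold cj
    rw [Matrix.charpoly_mul_comm, ← Matrix.mul_assoc, hU, Matrix.one_mul,
      Matrix.charpoly_diagonal]
  rw [h2, Polynomial.roots_prod] at h1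
  · simp only [Polynomial.roots_X_sub_C, Multiset.bind_singleton] at h1
    have h3 := congrArg (fun m => (m.map (fun z : ℂ => Real.negMulLog z.re)).sum) h1
    simp only [Multiset.map_map] at h3
    simpa [Finset.sum] using h3.symm
  · exact Finset.prod_ne_zero_iff.mpr (fun i _ => Polynomial.X_sub_C_ne_zero _)

lemma pinch {d : ℕ} {V ρ : Matrix (Fin d) (Fin d) ℂ} (hV : Vᴴ * V = 1) (hρ : ρ.PosSemidef) :
    vN ρ ≤ ∑ i, Real.negMulLog ((Vᴴ * ρ * V) i i).re := by
  have hA := hρ.1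
  set W := (hA.eigenvectorUnitary : Matrix (Fin d) (Fin d) ℂ) with hW
  have hWW : Wᴴ * W = 1 := eigU hA
  have hWW' : W * Wᴴ = 1 := mul_eq_one_comm.mp hWW
  have hV' : V * Vᴴ = 1 := mul_eq_one_comm.mp hV
  set x := hA.eigenvalues with hx
  have hx0 : ∀ i, 0 ≤ x i := hρ.eigenvalues_nonneg
  set T := Vᴴ * W with hT
  have hT1 : T * Tᴴ = 1 := by
    rw [hT, Matrix.conjTranspose_mul, Matrix.conjTranspose_conjTranspose, Matrix.mul_assoc,
      ← Matrix.mul_assoc W, hWW', Matrix.one_mul, hV]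
  have hT2 : Tᴴ * T = 1 := mul_eq_one_comm.mp hT1
  have hr : ∀ i, ∑ j, Complex.normSq (T i j) = 1 := by
    intro i
    have := congrFun (congrFun hT1 i) i
    rw [Matrix.mul_apply, Matrix.one_apply_eq] at this
    have h2 : ∑ j, ((Complex.normSq (T i j) : ℝ) : ℂ) = 1 := by
      rw [← this]
      refine Finset.sum_congr rfl fun j _ => ?_
      rw [Matrix.conjTranspose_apply, Complex.normSq_eq_conj_mul_self, mul_comm]
      rfl
    exact_mod_cast h2
  have hc : ∀ j, ∑ i, Complex.normSq (T i j) = 1 := by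
    intro i
    have := congrFun (congrFun hT2 i) i
    rw [Matrix.mul_apply, Matrix.one_apply_eq] at this
    have h2 : ∑ j, ((Complex.normSq (T j i) : ℝ) : ℂ) = 1 := by
      rw [← this]
      refine Finset.sum_congr rfl fun j _ => ?_
      rw [Matrix.conjTranspose_apply, Complex.normSq_eq_conj_mul_self]
      rfl
    exact_mod_cast h2
  have hd : ∀ i, ((Vᴴ * ρ * V) i i).re = ∑ j, Complex.normSq (T i j) * x j := by
    intro i
    have h1 : Vᴴ * ρ * V = T * Matrix.diagonal (fun i => (x i : ℂ)) * Tᴴ := by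
      conv_lhs => rw [cj_eig hA]
      unfold cj
      rw [hT, Matrix.conjTranspose_mul, Matrix.conjTranspose_conjTranspose]
      simp only [Matrix.mul_assoc]
      rfl
    have h2 : (Vᴴ * ρ * V) i i = ((∑ j, Complex.normSq (T i j) * x j : ℝ) : ℂ) := by
      rw [h1, Matrix.mul_apply]
      push_cast
      refine Finset.sum_congr rfl fun j _ => ?_
      rw [Matrix.mul_diagonal, Matrix.conjTranspose_apply, Complex.normSq_eq_conj_mul_self]
      change T i j * (x j : ℂ) * (starRingEnd ℂ) (T i j) = _
      ring
    rw [h2, Complex.ofReal_re]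
  rw [vN_eig hA]
  have hJ : ∀ i, ∑ j, Complex.normSq (T i j) * Real.negMulLog (x j) ≤
      Real.negMulLog ((Vᴴ * ρ * V) i i).re := by
    intro i
    rw [hd]
    exact Real.concaveOn_negMulLog.le_map_sum (t := Finset.univ)
      (w := fun j => Complex.normSq (T i j)) (p := x)
      (fun j _ => Complex.normSq_nonneg _) (hr i) (fun j _ => hx0 j)
  calc ∑ j, Real.negMulLog (x j) = ∑ j, (∑ i, Complex.normSq (T i j)) * Real.negMulLog (x j) := by
        simp [hc]
    _ = ∑ i, ∑ j, Complex.normSq (T i j) * Real.negMulLog (x j) := by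
        rw [Finset.sum_comm]
        simp [Finset.sum_mul]
    _ ≤ _ := Finset.sum_le_sum fun i _ => hJ i

lemma eta_bound {a b t : ℝ} (ha : 0 ≤ a) (hb : 0 ≤ b) (ht : 0 < t) (ht1 : t < 1) :
    Real.negMulLog ((1 - t) * a + t * b) ≤ Real.negMulLog a +
      (if a = 0 then Real.negMulLog b else (-Real.log a - 1) * (b - a)) * t +
      (if a = 0 then b else 0) * Real.negMulLog t := by
  by_cases h : a = 0
  · subst h
    simp [Real.negMulLog_mul]
    linarith
  · have ha' : 0 < a := lt_of_le_of_ne ha (Ne.symm h)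
    simp only [h, if_false]
    set x := (1 - t) * a + t * b with hx
    have hx0 : 0 < x := by
      have : 0 < (1 - t) * a := mul_pos (by linarith) ha'
      have : 0 ≤ t * b := by positivity
      linarith
    have h1 := Real.self_sub_one_le_mul_log (x := x / a) (by positivity)
    rw [Real.log_div hx0.ne' h] at h1
    have h2 : x - a ≤ x * (Real.log x - Real.log a) := by
      have := mul_le_mul_of_nonneg_left h1 ha
      have e1 : a * (x / a - 1) = x - a := by field_simp
      have e2 : a * (x / a * (Real.log x - Real.log a)) = x * (Real.log x - Real.log a) := by
        field_simp
      rwa [e1, e2] at this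
    have h3 : (b - a) * t = x - a := by rw [hx]; ring
    rw [mul_assoc, h3]
    unfold Real.negMulLog
    nlinarith

lemma upper {d : ℕ} {A B : Matrix (Fin d) (Fin d) ℂ} (hA : A.PosSemidef) (hB : B.PosSemidef)
    (hB1 : B.trace = 1) (hAB : 0 < (A * B).trace) :
    ∃ c C : ℝ, 0 < c ∧ ∀ t : ℝ, 0 < t → t < 1 →
      vN ((1 - t) • A + t • B) ≤ vN A + C * t + (1 - c) * Real.negMulLog t := by
  have hH := hA.1
  set V := (hH.eigenvectorUnitary : Matrix (Fin d) (Fin d) ℂ) with hV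
  have hVV : Vᴴ * V = 1 := eigU hH
  have hVV' : V * Vᴴ = 1 := mul_eq_one_comm.mp hVV
  set a := hH.eigenvalues with ha
  have ha0 : ∀ i, 0 ≤ a i := hA.eigenvalues_nonneg
  have hAe : A = cj V a := cj_eig hH
  have hVA : Vᴴ * A * V = Matrix.diagonal (fun i => (a i : ℂ)) := by
    rw [hAe]
    unfold cj
    simp only [Matrix.mul_assoc]
    rw [hVV, ← Matrix.mul_assoc Vᴴ, hVV]
    simp
  have hB' := hB.conjTranspose_mul_mul_same V
  set b : Fin d → ℝ := fun i => ((Vᴴ * B * V) i i).re with hb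
  have hb0 : ∀ i, 0 ≤ b i := fun i => (Complex.le_def.mp (hB'.diag_nonneg (i := i))).1
  have hbs : ∑ i, b i = 1 := by
    have : (Vᴴ * B * V).trace = 1 := by
      rw [Matrix.trace_mul_comm, ← Matrix.mul_assoc, hVV', Matrix.one_mul, hB1]
    have := congrArg Complex.re this
    simpa [Matrix.trace, hb] using this
  have hab : 0 < ∑ i, a i * b i := by
    have h1 : (A * B).trace = (Matrix.diagonal (fun i => (a i : ℂ)) * (Vᴴ * B * V)).trace := by
      conv_lhs => rw [hAe]
      unfold cj
      rw [Matrix.mul_assoc, Matrix.mul_assoc, Matrix.trace_mul_comm]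
      simp only [Matrix.mul_assoc]
    rw [h1] at hAB
    have := (Complex.lt_def.mp hAB).1
    simpa [Matrix.trace, Matrix.diagonal_mul, hb] using this
  refine ⟨∑ i, (if a i = 0 then 0 else b i),
    ∑ i, (if a i = 0 then Real.negMulLog (b i) else (-Real.log (a i) - 1) * (b i - a i)), ?_, ?_⟩
  · obtain ⟨i, _, hi⟩ := Finset.exists_lt_of_sum_lt (s := Finset.univ) (f := fun _ : Fin d => (0:ℝ))
      (g := fun i => a i * b i) (by simpa using hab)
    have hai : a i ≠ 0 := by
      intro h; simp [h] at hi
    have hbi : 0 < b i := by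
      rcases (hb0 i).lt_or_eq with h | h
      · exact h
      · simp [← h] at hi
    apply Finset.sum_pos'
    · intro j _
      split_ifs
      · exact le_rfl
      · exact hb0 j
    · exact ⟨i, Finset.mem_univ _, by simp [hai, hbi]⟩
  · intro t ht ht1
    have hps : ((1 - t) • A + t • B).PosSemidef :=
      (hA.smul (by linarith)).add (hB.smul ht.le)
    refine (pinch hVV hps).trans ?_
    have hd : ∀ i, ((Vᴴ * ((1 - t) • A + t • B) * V) i i).re = (1 - t) * a i + t * b i := by
      intro i
      rw [Matrix.mul_add, Matrix.add_mul, Matrix.mul_smul, Matrix.smul_mul, Matrix.mul_smul,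
        Matrix.smul_mul, hVA]
      simp [hb]
    have hc : 1 - ∑ i, (if a i = 0 then 0 else b i) = ∑ i, (if a i = 0 then b i else 0) := by
      rw [← hbs, ← Finset.sum_sub_distrib]
      refine Finset.sum_congr rfl fun i _ => ?_
      split_ifs <;> simp
    rw [hc, vN_eig hH, Finset.sum_mul, Finset.sum_mul, ← Finset.sum_add_distrib,
      ← Finset.sum_add_distrib]
    refine Finset.sum_le_sum fun i _ => ?_
    rw [hd]
    exact eta_bound (ha0 i) (hb0 i) ht ht1

lemma uncj {d : ℕ} {U X Y : Matrix (Fin d) (Fin d) ℂ} (hU' : U * Uᴴ = 1) (h : Uᴴ * X * U = Y) :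
    X = U * Y * Uᴴ := by
  rw [← h]
  have : U * (Uᴴ * X * U) * Uᴴ = (U * Uᴴ) * X * (U * Uᴴ) := by simp only [Matrix.mul_assoc]
  rw [this, hU']; simp

lemma cjT_mul {d : ℕ} {U : Matrix (Fin d) (Fin d) ℂ} (hU' : U * Uᴴ = 1)
    (X Y : Matrix (Fin d) (Fin d) ℂ) :
    (Uᴴ * X * U) * (Uᴴ * Y * U) = Uᴴ * (X * Y) * U := by
  have : (Uᴴ * X * U) * (Uᴴ * Y * U) = Uᴴ * X * (U * Uᴴ) * Y * U := by
    simp only [Matrix.mul_assoc]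
  rw [this, hU']; simp [Matrix.mul_assoc]

lemma simdiag_s6 {d : ℕ} {φ H : Matrix (Fin d) (Fin d) ℂ} (hφ : φ.PosSemidef) (hH : H.IsHermitian)
    (hH2 : H * H = H) (h1 : φ * H = φ) :
    ∃ (U : Matrix (Fin d) (Fin d) ℂ) (l p : Fin d → ℝ), Uᴴ * U = 1 ∧ φ = cj U l ∧ H = cj U p ∧
      (∀ i, 0 ≤ l i) ∧ (∀ i, p i = 0 ∨ p i = 1) ∧ (∀ i, p i = 0 → l i = 0) := by
  have hM : (φ - (1 - H)).IsHermitian := hφ.1.sub (Matrix.isHermitian_one.sub hH)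
  set U := (hM.eigenvectorUnitary : Matrix (Fin d) (Fin d) ℂ) with hUdef
  have hU : Uᴴ * U = 1 := eigU hM
  have hU' : U * Uᴴ = 1 := mul_eq_one_comm.mp hU
  set m := hM.eigenvalues with hm
  have hMe : φ - (1 - H) = cj U m := cj_eig hM
  set H' := Uᴴ * H * U with hH'
  set φ' := Uᴴ * φ * U with hφ'
  have hHp : H'.IsHermitian := Matrix.isHermitian_conjTranspose_mul_mul U hH
  have hφp : φ'.PosSemidef := hφ.conjTranspose_mul_mul_same U
  have hHH : H' * H' = H' := by rw [hH', cjT_mul hU', hH2]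
  have hφH : φ' * H' = φ' := by rw [hH', hφ', cjT_mul hU', h1]
  have hD : φ' - (1 - H') = Matrix.diagonal (fun i => (m i : ℂ)) := by
    have : φ' - (1 - H') = Uᴴ * (φ - (1 - H)) * U := by
      simp only [Matrix.mul_sub, Matrix.sub_mul, Matrix.mul_one, hU, hφ', hH']
    rw [this, hMe]
    unfold cj
    simp only [Matrix.mul_assoc]
    rw [hU, ← Matrix.mul_assoc Uᴴ, hU]; simp
  have hDH : Matrix.diagonal (fun i => (m i : ℂ)) * H' = φ' := by
    rw [← hD, Matrix.sub_mul, Matrix.sub_mul, hHH, hφH]; simp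
  have hDH' : Matrix.diagonal (fun i => (m i : ℂ)) * (1 - H') = -(1 - H') := by
    rw [Matrix.mul_sub, hDH, Matrix.mul_one, ← hD]
    abel
  have hHps : H'.PosSemidef := by
    have := Matrix.posSemidef_conjTranspose_mul_self H'
    rwa [hHp.eq, hHH] at this
  have key : ∀ i, (m i = -1 → ∀ j, H' i j = 0) ∧
      (m i ≠ -1 → ∀ j, H' i j = (1 : Matrix (Fin d) (Fin d) ℂ) i j) := by
    intro i
    constructor
    · intro hi
      have e1 : φ' i i = -H' i i := by
        rw [← hDH, Matrix.diagonal_mul, hi]; simp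
      have p1 := hφp.diag_nonneg (i := i)
      have p2 := hHps.diag_nonneg (i := i)
      have p3 : H' i i = 0 := by
        apply le_antisymm _ p2
        rw [e1] at p1
        exact neg_nonneg.mp p1
      have p4 : ∑ j, Complex.normSq (H' i j) = 0 := by
        have : (∑ j, ((Complex.normSq (H' i j) : ℝ) : ℂ)) = 0 := by
          rw [← p3]
          conv_rhs => rw [← hHH, Matrix.mul_apply]
          refine Finset.sum_congr rfl fun j _ => ?_
          rw [← hHp.apply j i, Complex.normSq_eq_conj_mul_self, mul_comm]
          rfl
        exact_mod_cast this
      intro j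
      have := (Finset.sum_eq_zero_iff_of_nonneg (fun j _ => Complex.normSq_nonneg (H' i j))).mp p4 j
        (Finset.mem_univ _)
      exact Complex.normSq_eq_zero.mp this
    · intro hi j
      have := congrFun (congrFun hDH' i) j
      rw [Matrix.diagonal_mul, Matrix.neg_apply] at this
      have h2 : ((m i + 1 : ℝ) : ℂ) * ((1 - H') i j) = 0 := by
        push_cast
        linear_combination this
      rcases mul_eq_zero.mp h2 with h | h
      · exact absurd (by have : m i + 1 = 0 := by exact_mod_cast h
                         linarith) hi
      · rw [Matrix.sub_apply] at h
        exact (sub_eq_zero.mp h).symm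
  set p : Fin d → ℝ := fun i => if m i = -1 then 0 else 1 with hp
  have hHd : H' = Matrix.diagonal (fun i => (p i : ℂ)) := by
    ext i j
    by_cases hi : m i = -1
    · rw [(key i).1 hi j]
      by_cases hij : i = j
      · subst hij; simp [hp, hi]
      · simp [hij]
    · rw [(key i).2 hi j]
      by_cases hij : i = j
      · subst hij; simp [hp, hi]
      · simp [hij]
  have hφd : φ' = Matrix.diagonal (fun i => ((m i * p i : ℝ) : ℂ)) := by
    rw [← hDH, hHd, Matrix.diagonal_mul_diagonal]
    simp
  refine ⟨U, fun i => m i * p i, p, hU, uncj hU' hφd, uncj hU' hHd, ?_, ?_, ?_⟩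
  · intro i
    have := hφp.diag_nonneg (i := i)
    rw [hφd, Matrix.diagonal_apply_eq] at this
    exact_mod_cast this
  · intro i
    by_cases hi : m i = -1 <;> simp [hp, hi]
  · intro i hi
    simp [hi]

lemma cj_commute {d : ℕ} {U X : Matrix (Fin d) (Fin d) ℂ} (hU : Uᴴ * U = 1) (l p r : Fin d → ℝ)
    (h1 : X * cj U l = cj U l * X) (h2 : X * cj U p = cj U p * X)
    (hr : ∀ i j, l i = l j → p i = p j → r i = r j) : X * cj U r = cj U r * X := by
  have hU' : U * Uᴴ = 1 := mul_eq_one_comm.mp hU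
  have a1 : ∀ y, Uᴴ * (X * cj U y) * U = (Uᴴ * X * U) * Matrix.diagonal (fun i => (y i : ℂ)) := by
    intro y
    unfold cj
    simp only [Matrix.mul_assoc]
    rw [hU]; simp
  have a2 : ∀ y, Uᴴ * (cj U y * X) * U = Matrix.diagonal (fun i => (y i : ℂ)) * (Uᴴ * X * U) := by
    intro y
    unfold cj
    simp only [Matrix.mul_assoc]
    rw [← Matrix.mul_assoc Uᴴ U, hU]; simp
  have a3 : ∀ y, X * cj U y = cj U y * X → ∀ i j, (Uᴴ * X * U) i j ≠ 0 → y i = y j := by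
    intro y hy i j hne
    have : (Uᴴ * X * U) * Matrix.diagonal (fun i => (y i : ℂ)) =
      Matrix.diagonal (fun i => (y i : ℂ)) * (Uᴴ * X * U) := by rw [← a1, ← a2, hy]
    have := congrFun (congrFun this i) j
    rw [Matrix.mul_diagonal, Matrix.diagonal_mul, mul_comm] at this
    have := mul_right_cancel₀ hne this
    exact_mod_cast this.symm
  have a4 : Uᴴ * (X * cj U r) * U = Uᴴ * (cj U r * X) * U := by
    rw [a1, a2]
    ext i j
    rw [Matrix.mul_diagonal, Matrix.diagonal_mul]
    by_cases hne : (Uᴴ * X * U) i j = 0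
    · rw [hne]; simp
    · rw [hr i j (a3 l h1 i j hne) (a3 p h2 i j hne), mul_comm]
  rw [uncj hU' rfl (X := X * cj U r), a4, ← uncj hU' rfl]

theorem minimizer_has_full_support {d d' : ℕ} (hd : 1 ≤ d) (hd' : 1 ≤ d')
    (Φ : Matrix (Fin d) (Fin d) ℂ →ₗ[ℂ] Matrix (Fin d') (Fin d') ℂ) (hΦ : IsPTP Φ)
    (Q : Matrix (Fin d) (Fin d) ℂ →ₗ[ℝ] ℝ)
    (P : Finset (Matrix (Fin d) (Fin d) ℂ)) (hP : IsOrthProjFamily P)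
    (hirr : ∀ ω ∈ DP P, ∀ ω' ∈ DP P,
      LinearMap.range (ω + ω').mulVecLin = LinearMap.range (∑ pr ∈ P, pr).mulVecLin →
        0 < ((Φ ω) * (Φ ω')).trace)
    (φ : Matrix (Fin d) (Fin d) ℂ) (hφ : φ ∈ DP P)
    (hmin : ∀ ω ∈ DP P, EPfun Φ Q φ ≤ EPfun Φ Q ω) :
    LinearMap.range φ.mulVecLin = LinearMap.range (∑ pr ∈ P, pr).mulVecLin := by
  obtain ⟨hP1, hP2⟩ := hP
  obtain ⟨⟨hφps, hφtr⟩, hφP⟩ := hφ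
  have hmemφ : φ ∈ DP P := ⟨⟨hφps, hφtr⟩, hφP⟩
  set H := ∑ pr ∈ P, pr with hHdef
  have hprH : ∀ pr ∈ P, pr * H = pr := by
    intro pr hpr
    rw [hHdef, Finset.mul_sum, Finset.sum_eq_single pr]
    · exact (hP1 pr hpr).2
    · intro q hq hne
      exact hP2 pr hpr q hq hne.symm
    · intro h; exact absurd hpr h
  have hHpr : ∀ pr ∈ P, H * pr = pr := by
    intro pr hpr
    rw [hHdef, Finset.sum_mul, Finset.sum_eq_single pr]
    · exact (hP1 pr hpr).2
    · intro q hq hne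
      exact hP2 q hq pr hpr hne
    · intro h; exact absurd hpr h
  have hHherm : H.IsHermitian := by
    unfold Matrix.IsHermitian
    rw [hHdef, Matrix.conjTranspose_sum]
    exact Finset.sum_congr rfl fun pr hpr => (hP1 pr hpr).1
  have hHH : H * H = H := by
    conv_lhs => rw [hHdef, Finset.sum_mul]
    exact Finset.sum_congr rfl hprH
  have hφH : φ * H = φ := by
    conv_lhs => rw [hφP, Finset.sum_mul]
    conv_rhs => rw [hφP]
    refine Finset.sum_congr rfl fun pr hpr => ?_
    rw [Matrix.mul_assoc, hprH pr hpr]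
  have hcomm : ∀ pr ∈ P, pr * φ = φ * pr := by
    intro pr hpr
    have e1 : pr * φ = pr * φ * pr := by
      conv_lhs => rw [hφP, Finset.mul_sum]
      rw [Finset.sum_eq_single pr]
      · rw [← Matrix.mul_assoc, ← Matrix.mul_assoc, (hP1 pr hpr).2]
      · intro q hq hne
        rw [← Matrix.mul_assoc, ← Matrix.mul_assoc, hP2 pr hpr q hq hne.symm]; simp
      · intro h; exact absurd hpr h
    have e2 : φ * pr = pr * φ * pr := by
      conv_lhs => rw [hφP, Finset.sum_mul]
      rw [Finset.sum_eq_single pr]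
      · rw [Matrix.mul_assoc, (hP1 pr hpr).2]
      · intro q hq hne
        rw [Matrix.mul_assoc, hP2 q hq pr hpr hne]; simp
      · intro h; exact absurd hpr h
    rw [e1, e2]
  obtain ⟨U, l, p, hU, hφU, hHU, hl0, hp01, hpl⟩ := simdiag_s6 hφps hHherm hHH hφH
  by_contra hne
  -- the missing directions
  set r : Fin d → ℝ := fun i => if p i = 1 ∧ l i = 0 then 1 else 0 with hr
  have hr0 : ∀ i, 0 ≤ r i := by
    intro i; simp only [hr]; split_ifs <;> norm_num
  have hex : ∃ i, p i = 1 ∧ l i = 0 := by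
    by_contra hcon
    push Not at hcon
    apply hne
    rw [hφU, hHU]
    apply le_antisymm
    · exact cj_range_le hU _ _ hpl
    · apply cj_range_le hU
      intro i hi
      rcases hp01 i with h | h
      · exact h
      · exact absurd hi (hcon i h)
  set k := ∑ i, r i with hk
  have hkpos : 0 < k := by
    obtain ⟨i, hi⟩ := hex
    exact Finset.sum_pos' (fun j _ => hr0 j) ⟨i, Finset.mem_univ _, by simp [hr, hi]⟩
  set w : Fin d → ℝ := fun i => r i / k with hw
  have hw0 : ∀ i, 0 ≤ w i := fun i => div_nonneg (hr0 i) hkpos.le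
  have hwsum : ∑ i, w i = 1 := by
    simp only [hw]
    rw [← Finset.sum_div]
    exact div_self hkpos.ne'
  have hlw : ∀ i, l i = 0 ∨ w i = 0 := by
    intro i
    by_cases h : l i = 0
    · exact Or.inl h
    · right; simp [hw, hr, h]
  have hpw : ∀ i, p i * w i = w i := by
    intro i
    rcases hp01 i with h | h
    · simp [hw, hr, h]
    · simp [h]
  set ω := cj U w with hω
  have hωps : ω.PosSemidef := cj_posSemidef U w hw0
  have hωtr : ω.trace = 1 := by rw [hω, cj_trace hU, hwsum]; simp
  have hωc : ∀ pr ∈ P, pr * ω = ω * pr := by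
    intro pr hpr
    apply cj_commute hU l p w
    · rw [← hφU]; exact hcomm pr hpr
    · rw [← hHU, hprH pr hpr, hHpr pr hpr]
    · intro i j h1 h2
      simp only [hw, hr, h1, h2]
  have hmemω : ω ∈ DP P := by
    refine ⟨⟨hωps, hωtr⟩, ?_⟩
    have e : ∑ pr ∈ P, pr * ω * pr = H * ω := by
      rw [hHdef, Finset.sum_mul]
      refine Finset.sum_congr rfl fun pr hpr => ?_
      rw [Matrix.mul_assoc, ← hωc pr hpr, ← Matrix.mul_assoc, (hP1 pr hpr).2]
    rw [e, hHU, hω, cj_mul hU]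
    simp only [hpw]
  have hpos : 0 < ((Φ φ) * (Φ ω)).trace := by
    apply hirr φ hmemφ ω hmemω
    have e : φ + ω = cj U (fun i => l i + w i) := by
      have := cj_comb U l w 1 1
      rw [← hφU] at this
      simpa using this
    rw [e, hHU]
    apply le_antisymm
    · apply cj_range_le hU
      intro i hi
      simp [hpl i hi, hw, hr, hi]
    · apply cj_range_le hU
      intro i hi
      rcases hp01 i with h | h
      · exact h
      · exfalso
        have h1 : l i = 0 := by linarith [hl0 i, hw0 i]
        have h2 : w i = 0 := by linarith [hl0 i, hw0 i]
        simp only [hw, hr, h, h1] at h2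
        simp [hkpos.ne'] at h2
  obtain ⟨c, C, hc, hup⟩ := upper (hΦ.1 _ hφps) (hΦ.1 _ hωps) ((hΦ.2 _).trans hωtr) hpos
  have hlsum : ∑ i, l i = 1 := by
    have := hφtr
    rw [hφU, cj_trace hU] at this
    exact_mod_cast this
  set Wc := ∑ i, Real.negMulLog (w i) with hWc
  have hlow : ∀ t : ℝ, 0 < t → t < 1 →
      (1 - t) * vN φ + Real.negMulLog t + t * Wc ≤ vN ((1 - t) • φ + t • ω) := by
    intro t ht ht1
    have e : (1 - t) • φ + t • ω = cj U (fun i => (1 - t) * l i + t * w i) := by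
      rw [hω, ← cj_comb, ← hφU]
    have e2 : ∀ i, Real.negMulLog ((1 - t) * l i + t * w i) =
        l i * Real.negMulLog (1 - t) + (1 - t) * Real.negMulLog (l i) +
        (w i * Real.negMulLog t + t * Real.negMulLog (w i)) := by
      intro i
      rcases hlw i with h | h
      · simp [h, Real.negMulLog_mul]
      · simp [h, Real.negMulLog_mul]
    have e3 : vN φ = ∑ i, Real.negMulLog (l i) := by rw [hφU, vN_cj hU]
    rw [e, vN_cj hU, e3]
    simp only [e2]
    rw [Finset.sum_add_distrib, Finset.sum_add_distrib, Finset.sum_add_distrib, ← Finset.sum_mul,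
      ← Finset.sum_mul, ← Finset.mul_sum, ← Finset.mul_sum, hlsum, hwsum]
    have := Real.negMulLog_nonneg (x := 1 - t) (by linarith) (by linarith)
    linarith
  have hmemt : ∀ t : ℝ, 0 < t → t < 1 → (1 - t) • φ + t • ω ∈ DP P := by
    intro t ht ht1
    refine ⟨⟨(hφps.smul (by linarith)).add (hωps.smul ht.le), ?_⟩, ?_⟩
    · rw [Matrix.trace_add, Matrix.trace_smul, Matrix.trace_smul, hφtr, hωtr, ← add_smul]
      simp
    · conv_lhs => rw [hφP, hmemω.2]
      rw [Finset.smul_sum, Finset.smul_sum, ← Finset.sum_add_distrib]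
      refine Finset.sum_congr rfl fun pr _ => ?_
      simp [Matrix.mul_add, Matrix.add_mul]
  set K := C + vN φ - Wc + Q ω - Q φ with hK
  have hfin : ∀ t : ℝ, 0 < t → t < 1 → c * (-Real.log t) ≤ K := by
    intro t ht ht1
    have h1 := hmin _ (hmemt t ht ht1)
    have h2 := hup t ht ht1
    have h3 := hlow t ht ht1
    unfold EPfun at h1
    rw [map_add Φ, LinearMap.map_smul_of_tower, LinearMap.map_smul_of_tower, map_add Q, map_smul,
      map_smul, smul_eq_mul, smul_eq_mul] at h1
    have h4 : c * Real.negMulLog t ≤ K * t := by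
      rw [hK]; nlinarith
    unfold Real.negMulLog at h4
    have h5 : (c * (-Real.log t)) * t ≤ K * t := by nlinarith
    exact le_of_mul_le_mul_right h5 ht
  have h := hfin (Real.exp (-((|K| + 1) / c))) (Real.exp_pos _)
    (by rw [Real.exp_lt_one_iff]; have : 0 < (|K| + 1) / c := by positivity
        linarith)
  rw [Real.log_exp, neg_neg, mul_div_cancel₀ _ hc.ne'] at h
  linarith [le_abs_self K]
end

section
/- Let ρ, φ be d×d density matrices and α > 0 such that φ − αρ is positive semidefinite (φ ≥ αρ in the Loewner order). Then supp ρ ⊆ supp φ and the quantum relative entropy satisfies S(ρ‖φ) ≤ −ln α. -/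
open Matrix
open scoped ComplexOrder

/-- Quadratic form inequality in the eigenbasis of `φ`. -/
lemma aux_quad {d : ℕ} (M : Matrix (Fin d) (Fin d) ℂ) (p q : Fin d → ℝ) (α : ℝ)
    (h : (Matrix.diagonal (fun i => (q i : ℂ)) -
      (α : ℂ) • (M * Matrix.diagonal (fun i => (p i : ℂ)) * Mᴴ)).PosSemidef)
    (x : Fin d → ℂ) :
    α * ∑ k, p k * ‖(Mᴴ *ᵥ x) k‖ ^ 2 ≤ ∑ j, q j * ‖x j‖ ^ 2 := by
  have h1 := h.dotProduct_mulVec_nonneg x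
  have e1 : star x ⬝ᵥ (Matrix.diagonal (fun i => (q i : ℂ)) *ᵥ x)
      = ((∑ j, q j * ‖x j‖ ^ 2 : ℝ) : ℂ) := by
    simp only [dotProduct, mulVec_diagonal, Pi.star_apply]
    push_cast
    refine Finset.sum_congr rfl fun j _ => ?_
    rw [← Complex.conj_mul']
    simp only [RCLike.star_def]
    ring
  have e2 : star x ⬝ᵥ ((M * Matrix.diagonal (fun i => (p i : ℂ)) * Mᴴ) *ᵥ x)
      = ((∑ k, p k * ‖(Mᴴ *ᵥ x) k‖ ^ 2 : ℝ) : ℂ) := by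
    rw [← mulVec_mulVec, ← mulVec_mulVec, dotProduct_mulVec]
    have : star x ᵥ* M = star (Mᴴ *ᵥ x) := by
      rw [star_mulVec, conjTranspose_conjTranspose]
    rw [this]
    simp only [dotProduct, mulVec_diagonal, Pi.star_apply]
    push_cast
    refine Finset.sum_congr rfl fun j _ => ?_
    rw [← Complex.conj_mul']
    simp only [RCLike.star_def]
    ring
  rw [sub_mulVec, dotProduct_sub, smul_mulVec, dotProduct_smul, e1, e2, smul_eq_mul,
    ← Complex.ofReal_mul, ← Complex.ofReal_sub, Complex.zero_le_real] at h1
  linarith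

lemma aux_zero {d : ℕ} (M : Matrix (Fin d) (Fin d) ℂ) (p q : Fin d → ℝ) (α : ℝ) (hα : 0 < α)
    (hp : ∀ i, 0 ≤ p i)
    (h : (Matrix.diagonal (fun i => (q i : ℂ)) -
      (α : ℂ) • (M * Matrix.diagonal (fun i => (p i : ℂ)) * Mᴴ)).PosSemidef)
    (i j : Fin d) (hj : q j = 0) : p i = 0 ∨ M j i = 0 := by
  have h1 := aux_quad M p q α h (Pi.single j 1)
  have h2 : ∑ k, q k * ‖(Pi.single j 1 : Fin d → ℂ) k‖ ^ 2 = 0 := by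
    refine Finset.sum_eq_zero fun k _ => ?_
    by_cases hk : k = j
    · subst hk; simp [hj]
    · simp [hk]
  have h3 : p i * ‖(Mᴴ *ᵥ Pi.single j 1) i‖ ^ 2 ≤ ∑ k, p k * ‖(Mᴴ *ᵥ Pi.single j 1) k‖ ^ 2 :=
    Finset.single_le_sum (f := fun k => p k * ‖(Mᴴ *ᵥ Pi.single j 1) k‖ ^ 2)
      (fun k _ => mul_nonneg (hp k) (by positivity)) (Finset.mem_univ i)
  have h4 : 0 ≤ p i * ‖(Mᴴ *ᵥ Pi.single j 1) i‖ ^ 2 := mul_nonneg (hp i) (by positivity)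
  have h5 : p i * ‖(Mᴴ *ᵥ Pi.single j 1) i‖ ^ 2 = 0 := by
    rw [h2] at h1
    have := nonpos_of_mul_nonpos_right h1 hα
    linarith
  simpa using h5

lemma aux_log {d : ℕ} (M : Matrix (Fin d) (Fin d) ℂ) (p q : Fin d → ℝ) (α : ℝ) (hα : 0 < α)
    (hp : ∀ i, 0 ≤ p i) (hq : ∀ i, 0 ≤ q i)
    (h : (Matrix.diagonal (fun i => (q i : ℂ)) -
      (α : ℂ) • (M * Matrix.diagonal (fun i => (p i : ℂ)) * Mᴴ)).PosSemidef)
    (i : Fin d) (hM : ∑ j, ‖M j i‖ ^ 2 = 1) :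
    p i * (Real.log (p i) - ∑ j, ‖M j i‖ ^ 2 * Real.log (q j)) ≤ p i * (-Real.log α) := by
  rcases (hp i).eq_or_lt with h0 | h0
  · simp [← h0]
  refine mul_le_mul_of_nonneg_left ?_ (hp i)
  set s : ℝ := ∑ j, (q j)⁻¹ * ‖M j i‖ ^ 2 with hs
  have hs0 : 0 ≤ s := Finset.sum_nonneg fun j _ => mul_nonneg (inv_nonneg.2 (hq j)) (by positivity)
  have hx := aux_quad M p q α h (fun j => ((q j)⁻¹ : ℂ) * M j i)
  have r1 : ∑ j, q j * ‖((q j)⁻¹ : ℂ) * M j i‖ ^ 2 = s := by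
    refine Finset.sum_congr rfl fun j _ => ?_
    rw [norm_mul, mul_pow, norm_inv, Complex.norm_real, Real.norm_eq_abs, inv_pow, sq_abs]
    by_cases hj : q j = 0
    · simp [hj]
    · field_simp
  have r2 : (Mᴴ *ᵥ (fun j => ((q j)⁻¹ : ℂ) * M j i)) i = (s : ℂ) := by
    simp only [mulVec, dotProduct, conjTranspose_apply, hs]
    push_cast
    refine Finset.sum_congr rfl fun j _ => ?_
    rw [← Complex.conj_mul']
    simp only [RCLike.star_def]
    ring
  have r3 := Finset.single_le_sum
      (f := fun k => p k * ‖(Mᴴ *ᵥ (fun j => ((q j)⁻¹ : ℂ) * M j i)) k‖ ^ 2)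
      (fun k _ => mul_nonneg (hp k) (by positivity)) (Finset.mem_univ i)
  simp only [r2, Complex.norm_real, Real.norm_eq_abs, sq_abs] at r3
  rw [r1] at hx
  have r4 : α * (p i * s ^ 2) ≤ s := (mul_le_mul_of_nonneg_left r3 hα.le).trans hx
  have r5 : α * p i * s ≤ 1 := by
    rcases hs0.eq_or_lt with h1 | h1
    · rw [← h1]; simp
    · refine le_of_mul_le_mul_right ?_ h1
      linarith
  have r6 : ∀ j, ‖M j i‖ ^ 2 * (Real.log (α * p i) - Real.log (q j)) ≤
      α * p i * ((q j)⁻¹ * ‖M j i‖ ^ 2) - ‖M j i‖ ^ 2 := by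
    intro j
    rcases (hq j).eq_or_lt with h1 | h1
    · rcases aux_zero M p q α hα hp h i j h1.symm with h2 | h2
      · exact absurd h2 h0.ne'
      · simp [h2]
    · have := Real.log_le_sub_one_of_pos (x := α * p i / q j) (by positivity)
      rw [Real.log_div (by positivity) h1.ne'] at this
      have := mul_le_mul_of_nonneg_left this (sq_nonneg ‖M j i‖)
      refine this.trans (le_of_eq ?_)
      rw [div_eq_mul_inv]
      ring
  have r7 := Finset.sum_le_sum fun j (_ : j ∈ Finset.univ) => r6 j
  rw [Finset.sum_sub_distrib, ← Finset.mul_sum, ← hs, hM] at r7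
  simp only [mul_sub] at r7
  rw [Finset.sum_sub_distrib, ← Finset.sum_mul, hM, Real.log_mul hα.ne' h0.ne'] at r7
  linarith

/-- If `φ ≥ α ρ` in the Loewner order for some `α > 0`, then `supp ρ ⊆ supp φ` and
`S(ρ‖φ) ≤ −ln α`. -/
theorem relEnt_le_of_loewner {d : ℕ} (hd : 1 ≤ d)
    (ρ φ : Matrix (Fin d) (Fin d) ℂ) (hρ : IsDensity ρ) (hφ : IsDensity φ)
    (α : ℝ) (hα : 0 < α) (h : (φ - (α : ℂ) • ρ).PosSemidef) :
    SuppLE ρ φ ∧ qRelEnt ρ φ ≤ -Real.log α := by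
  obtain ⟨hρ, hρt⟩ := hρ
  obtain ⟨hφ, -⟩ := hφ
  have hp := hρ.eigenvalues_nonneg
  have hq := hφ.eigenvalues_nonneg
  have sρ := hρ.1.spectral_theorem
  have sφ := hφ.1.spectral_theorem
  have htr := hρ.1.trace_eq_sum_eigenvalues
  have lρ : matLog ρ = _ := dif_pos hρ.1
  have lφ : matLog φ = _ := dif_pos hφ.1
  rw [Unitary.conjStarAlgAut_apply] at sρ sφ
  have hU1 := Unitary.star_mul_self_of_mem hρ.1.eigenvectorUnitary.2
  have hW1 := Unitary.star_mul_self_of_mem hφ.1.eigenvectorUnitary.2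
  have hW2 := Unitary.mul_star_self_of_mem hφ.1.eigenvectorUnitary.2
  generalize hρ.1.eigenvalues = p at *
  generalize hφ.1.eigenvalues = q at *
  generalize (hρ.1.eigenvectorUnitary : Matrix (Fin d) (Fin d) ℂ) = U at *
  generalize (hφ.1.eigenvectorUnitary : Matrix (Fin d) (Fin d) ℂ) = W at *
  change ρ = U * Matrix.diagonal (fun i => (p i : ℂ)) * star U at sρ
  change φ = W * Matrix.diagonal (fun i => (q i : ℂ)) * star W at sφ
  rw [star_eq_conjTranspose] at *
  set P := Matrix.diagonal (fun i => (p i : ℂ)) with hP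
  set Q := Matrix.diagonal (fun i => (q i : ℂ)) with hQ
  have key : (Q - (α : ℂ) • ((Wᴴ * U) * P * (Wᴴ * U)ᴴ)).PosSemidef := by
    have h1 := h.conjTranspose_mul_mul_same W
    have e1 : Wᴴ * φ * W = Q := by
      rw [sφ]
      calc _ = (Wᴴ * W) * Q * (Wᴴ * W) := by simp only [Matrix.mul_assoc]
        _ = Q := by rw [hW1]; simp
    have e2 : Wᴴ * ρ * W = (Wᴴ * U) * P * (Wᴴ * U)ᴴ := by
      rw [sρ, conjTranspose_mul, conjTranspose_conjTranspose]
      simp only [Matrix.mul_assoc]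
    rwa [Matrix.mul_sub, Matrix.sub_mul, Matrix.mul_smul, Matrix.smul_mul, e1, e2] at h1
  have hMM : (Wᴴ * U)ᴴ * (Wᴴ * U) = 1 := by
    rw [conjTranspose_mul, conjTranspose_conjTranspose]
    calc _ = Uᴴ * (W * Wᴴ) * U := by simp only [Matrix.mul_assoc]
      _ = 1 := by rw [hW2]; simpa using hU1
  have hUM : U = W * (Wᴴ * U) := by rw [← Matrix.mul_assoc, hW2, Matrix.one_mul]
  generalize hMdef : Wᴴ * U = M at *
  have hcol : ∀ i, ∑ j, ‖M j i‖ ^ 2 = 1 := by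
    intro i
    have := congrFun (congrFun hMM i) i
    rw [Matrix.mul_apply, Matrix.one_apply_eq] at this
    simp only [conjTranspose_apply, RCLike.star_def, Complex.conj_mul'] at this
    exact_mod_cast this
  constructor
  · have hQM : Q * (Matrix.diagonal (fun i => ((q i)⁻¹ : ℂ)) * (M * P)) = M * P := by
      ext j i
      rw [hQ, hP, diagonal_mul, diagonal_mul, mul_diagonal]
      by_cases hj : q j = 0
      · rcases aux_zero M p q α hα hp key i j hj with h2 | h2 <;> simp [h2]
      · have : (q j : ℂ) ≠ 0 := by exact_mod_cast hj
        field_simp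
    have hY : ρ = φ * (W * (Matrix.diagonal (fun i => ((q i)⁻¹ : ℂ)) * (M * P)) * Uᴴ) := by
      calc ρ = W * (M * P) * Uᴴ := by
            rw [← Matrix.mul_assoc, ← hUM]; exact sρ
        _ = W * (Q * (Matrix.diagonal (fun i => ((q i)⁻¹ : ℂ)) * (M * P))) * Uᴴ := by rw [hQM]
        _ = W * (Q * ((Wᴴ * W) * (Matrix.diagonal (fun i => ((q i)⁻¹ : ℂ)) * (M * P)))) * Uᴴ := by
            rw [hW1, Matrix.one_mul]
        _ = (W * Q * Wᴴ) * (W * (Matrix.diagonal (fun i => ((q i)⁻¹ : ℂ)) * (M * P)) * Uᴴ) := by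
            simp only [Matrix.mul_assoc]
        _ = _ := by rw [← sφ]
    unfold SuppLE
    rw [hY, Matrix.mulVecLin_mul]
    exact LinearMap.range_comp_le_range _ _
  · have t1 : (ρ * matLog ρ).trace = ((∑ i, p i * Real.log (p i) : ℝ) : ℂ) := by
      rw [lρ, sρ]
      set L := Matrix.diagonal (fun i => (Real.log (p i) : ℂ)) with hL
      calc _ = (U * (P * (Uᴴ * U) * L * Uᴴ)).trace := by simp only [Matrix.mul_assoc]
        _ = (P * L * (Uᴴ * U)).trace := by
          rw [hU1, Matrix.trace_mul_comm, Matrix.mul_one, Matrix.mul_assoc _ Uᴴ, hU1]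
        _ = _ := by
          rw [hU1, Matrix.mul_one, hP, hL, diagonal_mul_diagonal, trace_diagonal]
          push_cast
          rfl
    have t2 : (ρ * matLog φ).trace
        = ((∑ i, p i * ∑ j, ‖M j i‖ ^ 2 * Real.log (q j) : ℝ) : ℂ) := by
      rw [lφ, sρ]
      set L := Matrix.diagonal (fun i => (Real.log (q i) : ℂ)) with hL
      have hM' : Uᴴ * W = Mᴴ := by
        rw [← hMdef, conjTranspose_mul, conjTranspose_conjTranspose]
      calc _ = (U * (P * ((Uᴴ * W) * L * Wᴴ))).trace := by simp only [Matrix.mul_assoc]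
        _ = (P * (Mᴴ * (L * M))).trace := by
          rw [Matrix.trace_mul_comm, hM', ← hMdef]; simp only [Matrix.mul_assoc]
        _ = _ := by
          rw [hP, hL]
          simp only [Matrix.trace, Matrix.diag_apply, diagonal_mul]
          push_cast
          refine Finset.sum_congr rfl fun i _ => ?_
          rw [Matrix.mul_apply]
          congr 1
          refine Finset.sum_congr rfl fun j _ => ?_
          rw [diagonal_mul, conjTranspose_apply, ← Complex.conj_mul', RCLike.star_def]
          ring
    have hsum : ∑ i, p i = 1 := by
      rw [hρt] at htr
      have h2 := congrArg Complex.re htr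
      simpa using h2.symm
    unfold qRelEnt
    rw [Matrix.mul_sub, Matrix.trace_sub, t1, t2, ← Complex.ofReal_sub, Complex.ofReal_re,
      ← Finset.sum_sub_distrib]
    simp only [← mul_sub]
    refine (Finset.sum_le_sum fun i _ => aux_log M p q α hα hp hq key i (hcol i)).trans ?_
    rw [← Finset.sum_mul, hsum, one_mul]
end
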